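/- There exists a constant C > 0, depending only on T, α, β, K and δ, such that for every classical solution (v,u,θ,w,b) of the planar compressible MHD system on ℝ × [0,T] with (K,δ)-admissible initial data, one has ∫₀^T ∫_ℝ ( |b_x|² + |w_x|² ) dx dt ≤ C. -/

import Mathlib

open MeasureTheory Set Filter

noncomputable section

/-- Viscosity function `μ(z) = 1 + α z^(−α)` (here `μ̃₁ = 1`, `μ̃₂ = α`). -/
def visc (α z : ℝ) : ℝ := 1 + α * z ^ (-α)

/-- Squared Euclidean norm on `ℝ × ℝ` (used for the transverse fields `w, b ∈ ℝ²`). -/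
def sq2 (p : ℝ × ℝ) : ℝ := p.1 ^ 2 + p.2 ^ 2

/-- Partial derivative with respect to the first (spatial) variable. -/
def pdx {E : Type*} [NormedAddCommGroup E] [NormedSpace ℝ E]
    (f : ℝ → ℝ → E) (x t : ℝ) : E := deriv (fun y => f y t) x

/-- Partial derivative with respect to the second (time) variable, taken within `[0, T]`
(so it is one-sided at the endpoints). -/
def pdt (T : ℝ) {E : Type*} [NormedAddCommGroup E] [NormedSpace ℝ E]
    (f : ℝ → ℝ → E) (x t : ℝ) : E := derivWithin (fun s => f x s) (Icc 0 T) t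

/-- A classical solution of the planar compressible MHD system (in Lagrangian coordinates,
with all physical constants normalized to `1` and `μ̃₂ = α`) on `ℝ × [0,T]`:
all the derivatives appearing in the equations exist and are continuous, `v, θ > 0`,
the five equations hold pointwise, the solution tends to `(1,0,1,0,0)` as `|x| → ∞`
uniformly in `t ∈ [0,T]`, and `v−1, u, θ−1, b, w` and their first spatial derivatives
are square-integrable in `x` for each `t ∈ [0,T]`. -/
structure IsClassicalSolution (α β T : ℝ) (v u θ : ℝ → ℝ → ℝ)
    (w b : ℝ → ℝ → ℝ × ℝ) : Prop where
  v_pos : ∀ x : ℝ, ∀ t ∈ Icc (0:ℝ) T, 0 < v x t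
  θ_pos : ∀ x : ℝ, ∀ t ∈ Icc (0:ℝ) T, 0 < θ x t
  diff_x : ∀ x : ℝ, ∀ t ∈ Icc (0:ℝ) T,
    DifferentiableAt ℝ (fun y => v y t) x ∧ DifferentiableAt ℝ (fun y => u y t) x ∧
    DifferentiableAt ℝ (fun y => θ y t) x ∧ DifferentiableAt ℝ (fun y => w y t) x ∧
    DifferentiableAt ℝ (fun y => b y t) x
  diff_xx : ∀ x : ℝ, ∀ t ∈ Icc (0:ℝ) T,
    DifferentiableAt ℝ (fun y => pdx u y t) x ∧ DifferentiableAt ℝ (fun y => pdx θ y t) x ∧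
    DifferentiableAt ℝ (fun y => pdx w y t) x ∧ DifferentiableAt ℝ (fun y => pdx b y t) x
  diff_t : ∀ x : ℝ, ∀ t ∈ Icc (0:ℝ) T,
    DifferentiableWithinAt ℝ (fun s => v x s) (Icc 0 T) t ∧
    DifferentiableWithinAt ℝ (fun s => u x s) (Icc 0 T) t ∧
    DifferentiableWithinAt ℝ (fun s => θ x s) (Icc 0 T) t ∧
    DifferentiableWithinAt ℝ (fun s => w x s) (Icc 0 T) t ∧
    DifferentiableWithinAt ℝ (fun s => b x s) (Icc 0 T) t
  cont : ContinuousOn (fun p : ℝ × ℝ =>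
      (v p.1 p.2, u p.1 p.2, θ p.1 p.2, w p.1 p.2, b p.1 p.2)) (univ ×ˢ Icc 0 T)
  cont_dx : ContinuousOn (fun p : ℝ × ℝ =>
      (pdx v p.1 p.2, pdx u p.1 p.2, pdx θ p.1 p.2, pdx w p.1 p.2, pdx b p.1 p.2))
      (univ ×ˢ Icc 0 T)
  cont_dxx : ContinuousOn (fun p : ℝ × ℝ =>
      (pdx (pdx u) p.1 p.2, pdx (pdx θ) p.1 p.2, pdx (pdx w) p.1 p.2, pdx (pdx b) p.1 p.2))
      (univ ×ˢ Icc 0 T)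
  cont_dt : ContinuousOn (fun p : ℝ × ℝ =>
      (pdt T v p.1 p.2, pdt T u p.1 p.2, pdt T θ p.1 p.2, pdt T w p.1 p.2, pdt T b p.1 p.2))
      (univ ×ˢ Icc 0 T)
  eq_mass : ∀ x : ℝ, ∀ t ∈ Icc (0:ℝ) T, pdt T v x t = pdx u x t
  eq_mom : ∀ x : ℝ, ∀ t ∈ Icc (0:ℝ) T,
    pdt T u x t + pdx (fun y s => θ y s / v y s + sq2 (b y s) / 2) x t
      = pdx (fun y s => visc α (v y s) * pdx u y s / v y s) x t
  eq_w : ∀ x : ℝ, ∀ t ∈ Icc (0:ℝ) T,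
    pdt T w x t - pdx b x t = pdx (fun y s => (v y s)⁻¹ • pdx w y s) x t
  eq_b : ∀ x : ℝ, ∀ t ∈ Icc (0:ℝ) T,
    pdt T (fun y s => v y s • b y s) x t - pdx w x t
      = pdx (fun y s => (v y s)⁻¹ • pdx b y s) x t
  eq_temp : ∀ x : ℝ, ∀ t ∈ Icc (0:ℝ) T,
    pdt T θ x t + θ x t / v x t * pdx u x t
      = pdx (fun y s => θ y s ^ β * pdx θ y s / v y s) x t
        + (visc α (v x t) * pdx u x t ^ 2 + sq2 (pdx w x t) + sq2 (pdx b x t)) / v x t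
  farfield : ∀ ε > (0:ℝ), ∃ M : ℝ, ∀ x : ℝ, ∀ t ∈ Icc (0:ℝ) T, M ≤ |x| →
    |v x t - 1| < ε ∧ |u x t| < ε ∧ |θ x t - 1| < ε ∧
    Real.sqrt (sq2 (b x t)) < ε ∧ Real.sqrt (sq2 (w x t)) < ε
  sq_int : ∀ t ∈ Icc (0:ℝ) T,
    Integrable (fun x => (v x t - 1) ^ 2) ∧ Integrable (fun x => (u x t) ^ 2) ∧
    Integrable (fun x => (θ x t - 1) ^ 2) ∧ Integrable (fun x => sq2 (b x t)) ∧
    Integrable (fun x => sq2 (w x t)) ∧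
    Integrable (fun x => (pdx v x t) ^ 2) ∧ Integrable (fun x => (pdx u x t) ^ 2) ∧
    Integrable (fun x => (pdx θ x t) ^ 2) ∧ Integrable (fun x => sq2 (pdx b x t)) ∧
    Integrable (fun x => sq2 (pdx w x t))

/-- The initial data of a solution are `(K, δ)`-admissible: the `H¹`-type norm of
`(v₀−1, u₀, θ₀−1, b₀, w₀)` is at most `K²` and `v₀ ≥ δ`, `θ₀ ≥ δ`. -/
def Admissible (K δ : ℝ) (v u θ : ℝ → ℝ → ℝ) (w b : ℝ → ℝ → ℝ × ℝ) : Prop :=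
  (∫ x : ℝ, ((v x 0 - 1) ^ 2 + (u x 0) ^ 2 + (θ x 0 - 1) ^ 2 + sq2 (b x 0) + sq2 (w x 0)
      + (pdx v x 0) ^ 2 + (pdx u x 0) ^ 2 + (pdx θ x 0) ^ 2
      + sq2 (pdx b x 0) + sq2 (pdx w x 0))) ≤ K ^ 2 ∧
  (∀ x : ℝ, δ ≤ v x 0) ∧ (∀ x : ℝ, δ ≤ θ x 0)

/-! ### Calculus on strips -/

lemma continuous_integral_strip {f : ℝ → ℝ → ℝ} (hf : Continuous fun p : ℝ × ℝ => f p.1 p.2)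
    (a b : ℝ) : Continuous fun t => ∫ x in a..b, f x t :=
  intervalIntegral.continuous_parametric_intervalIntegral_of_continuous'
    (f := fun t x => f x t) (by exact hf.comp continuous_swap) a b

lemma continuous_slice_left {f : ℝ → ℝ → ℝ} (hf : Continuous fun p : ℝ × ℝ => f p.1 p.2) (t : ℝ) :
    Continuous fun x => f x t :=
  hf.comp (by fun_prop : Continuous fun x : ℝ => (x, t))

lemma continuous_slice_right {f : ℝ → ℝ → ℝ} (hf : Continuous fun p : ℝ × ℝ => f p.1 p.2) (x : ℝ) :
    Continuous fun t => f x t :=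
  hf.comp (by fun_prop : Continuous fun t : ℝ => (x, t))

/-- The integral of `f` over the space-time rectangle `[a, b] × [0, τ]`. -/
def rectInt (a b τ : ℝ) (f : ℝ → ℝ → ℝ) : ℝ := ∫ t in (0 : ℝ)..τ, ∫ x in a..b, f x t

section rectInt

variable {a b τ : ℝ} {f g : ℝ → ℝ → ℝ}

lemma rectInt_mono (hab : a ≤ b) (hτ : 0 ≤ τ) (hf : Continuous fun p : ℝ × ℝ => f p.1 p.2)
    (hg : Continuous fun p : ℝ × ℝ => g p.1 p.2)
    (h : ∀ x ∈ Icc a b, ∀ t ∈ Icc 0 τ, f x t ≤ g x t) : rectInt a b τ f ≤ rectInt a b τ g := by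
  refine intervalIntegral.integral_mono_on hτ
    ((continuous_integral_strip hf a b).intervalIntegrable _ _)
    ((continuous_integral_strip hg a b).intervalIntegrable _ _) fun t ht => ?_
  exact intervalIntegral.integral_mono_on hab
    ((continuous_slice_left hf t).intervalIntegrable _ _)
    ((continuous_slice_left hg t).intervalIntegrable _ _) fun x hx => h x hx t ht

lemma rectInt_add (hf : Continuous fun p : ℝ × ℝ => f p.1 p.2)
    (hg : Continuous fun p : ℝ × ℝ => g p.1 p.2) :
    rectInt a b τ (fun x t => f x t + g x t) = rectInt a b τ f + rectInt a b τ g := by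
  unfold rectInt
  rw [← intervalIntegral.integral_add ((continuous_integral_strip hf a b).intervalIntegrable _ _)
    ((continuous_integral_strip hg a b).intervalIntegrable _ _)]
  congr 1
  ext t
  exact intervalIntegral.integral_add ((continuous_slice_left hf t).intervalIntegrable _ _)
    ((continuous_slice_left hg t).intervalIntegrable _ _)

lemma rectInt_const_mul (c : ℝ) :
    rectInt a b τ (fun x t => c * f x t) = c * rectInt a b τ f := by
  simp [rectInt, intervalIntegral.integral_const_mul]

lemma rectInt_nonneg (hab : a ≤ b) (hτ : 0 ≤ τ) (h : ∀ x ∈ Icc a b, ∀ t ∈ Icc 0 τ, 0 ≤ f x t) :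
    0 ≤ rectInt a b τ f :=
  intervalIntegral.integral_nonneg hτ fun t ht =>
    intervalIntegral.integral_nonneg hab fun x hx => h x hx t ht

lemma integral_le_of_subinterval {h : ℝ → ℝ} {c d : ℝ} (hc : Continuous h) (h0 : ∀ x, 0 ≤ h x)
    (hca : c ≤ a) (hab : a ≤ b) (hbd : b ≤ d) :
    ∫ x in a..b, h x ≤ ∫ x in c..d, h x :=
  intervalIntegral.integral_mono_interval hca hab hbd (ae_of_all _ h0)
    (hc.intervalIntegrable _ _)

lemma rectInt_le_of_subinterval {c d : ℝ} (hτ : 0 ≤ τ)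
    (hf : Continuous fun p : ℝ × ℝ => f p.1 p.2) (h0 : ∀ x t, 0 ≤ f x t)
    (hca : c ≤ a) (hab : a ≤ b) (hbd : b ≤ d) :
    rectInt a b τ f ≤ rectInt c d τ f :=
  intervalIntegral.integral_mono_on hτ
    ((continuous_integral_strip hf a b).intervalIntegrable _ _)
    ((continuous_integral_strip hf c d).intervalIntegrable _ _) fun t _ =>
    integral_le_of_subinterval (continuous_slice_left hf t) (fun x => h0 x t) hca hab hbd

end rectInt

/-- Space-time balance law `E_t = J_x - S` integrated over a rectangle. -/
lemma integral_sub_eq_of_balance {T τ a b : ℝ} (hτ : τ ∈ Icc 0 T) {E Et J S : ℝ → ℝ → ℝ}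
    (hE : ∀ x, ∀ t ∈ Icc 0 T, HasDerivWithinAt (fun s => E x s) (Et x t) (Icc 0 T) t)
    (hJ : ∀ x, ∀ t ∈ Icc 0 T, HasDerivAt (fun y => J y t) (Et x t + S x t) x)
    (cE : Continuous fun p : ℝ × ℝ => E p.1 p.2) (cEt : Continuous fun p : ℝ × ℝ => Et p.1 p.2)
    (cS : Continuous fun p : ℝ × ℝ => S p.1 p.2) :
    (∫ x in a..b, E x τ) - (∫ x in a..b, E x 0)
      = ∫ t in (0 : ℝ)..τ, (J b t - J a t - ∫ x in a..b, S x t) := by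
  have h1 : ∀ x, E x τ - E x 0 = ∫ t in (0 : ℝ)..τ, Et x t := by
    intro x
    refine (intervalIntegral.integral_eq_sub_of_hasDeriv_right_of_le hτ.1
      (continuous_slice_right cE x).continuousOn (fun t ht => ?_)
      ((continuous_slice_right cEt x).intervalIntegrable _ _)).symm
    have ht' : t ∈ Ioo 0 T := ⟨ht.1, ht.2.trans_le hτ.2⟩
    exact ((hE x t (Ioo_subset_Icc_self ht')).hasDerivAt
      (Icc_mem_nhds ht'.1 ht'.2)).hasDerivWithinAt
  rw [← intervalIntegral.integral_sub ((continuous_slice_left cE τ).intervalIntegrable _ _)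
    ((continuous_slice_left cE 0).intervalIntegrable _ _)]
  simp_rw [h1]
  rw [intervalIntegral_intervalIntegral_swap (F := Et)]
  swap
  · have hK : IntegrableOn (fun p : ℝ × ℝ => Et p.1 p.2) (uIcc a b ×ˢ uIcc 0 τ)
        volume :=
      cEt.continuousOn.integrableOn_compact (isCompact_uIcc.prod isCompact_uIcc)
    exact hK.mono_set (Set.prod_mono uIoc_subset_uIcc uIoc_subset_uIcc)
  refine intervalIntegral.integral_congr fun t ht => ?_
  rw [uIcc_of_le hτ.1] at ht
  have ht' : t ∈ Icc 0 T := ⟨ht.1, ht.2.trans hτ.2⟩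
  have i1 := (continuous_slice_left cEt t).intervalIntegrable (μ := volume) a b
  have i2 := (continuous_slice_left cS t).intervalIntegrable (μ := volume) a b
  have := intervalIntegral.integral_eq_sub_of_hasDerivAt (fun x _ => hJ x t ht') (i1.add i2)
  rw [intervalIntegral.integral_add i1 i2] at this
  linarith

/-- A function on a unit interval is bounded by its mean plus the integral of its slope. -/
lemma le_integral_add_integral_of_abs_deriv_le {f f' g : ℝ → ℝ} {a x : ℝ}
    (hf : ∀ y, HasDerivAt f (f' y) y) (hg : Continuous g)
    (hf' : Continuous f') (hfg : ∀ y, |f' y| ≤ g y) (hx : x ∈ Icc a (a + 1)) :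
    f x ≤ (∫ y in a..a + 1, f y) + ∫ y in a..a + 1, g y := by
  have cf : Continuous f := continuous_iff_continuousAt.2 fun y => (hf y).continuousAt
  have key : ∀ y ∈ Icc a (a + 1), f x - (∫ z in a..a + 1, g z) ≤ f y := by
    intro y hy
    have h1 : ∫ z in y..x, f' z = f x - f y :=
      intervalIntegral.integral_eq_sub_of_hasDerivAt (fun z _ => hf z)
        (hf'.intervalIntegrable _ _)
    have h2 : |∫ z in y..x, f' z| ≤ |∫ z in y..x, g z| :=
      intervalIntegral.norm_integral_le_abs_of_norm_le (f := f')
        (ae_of_all _ fun z => hfg z) (hg.intervalIntegrable _ _)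
    have g0 : ∀ z, 0 ≤ g z := fun z => (abs_nonneg _).trans (hfg z)
    have h3 : |∫ z in y..x, g z| ≤ ∫ z in a..a + 1, g z := by
      rcases le_total y x with h | h
      · rw [abs_of_nonneg (intervalIntegral.integral_nonneg h fun z _ => g0 z)]
        exact integral_le_of_subinterval hg g0 hy.1 h hx.2
      · rw [intervalIntegral.integral_symm, abs_neg,
          abs_of_nonneg (intervalIntegral.integral_nonneg h fun z _ => g0 z)]
        exact integral_le_of_subinterval hg g0 hx.1 h hy.2
    have := (le_abs_self _).trans (h2.trans h3)
    linarith
  have := intervalIntegral.integral_mono_on (by linarith : a ≤ a + 1)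
    (continuous_const.intervalIntegrable (μ := volume) _ _)
    (cf.intervalIntegrable _ _) key
  simp at this
  linarith

/-- Integral form of Grönwall's inequality with constant coefficient. -/
lemma exists_gronwall_bound (A B T : ℝ) (hB : 0 ≤ B) :
    ∃ C : ℝ, 0 < C ∧ ∀ M : ℝ → ℝ, Continuous M →
      (∀ τ ∈ Icc 0 T, M τ ≤ A + B * ∫ s in (0 : ℝ)..τ, M s) → ∀ τ ∈ Icc 0 T, M τ ≤ C := by
  refine ⟨|A| * Real.exp (B * |T|) + 1, by positivity, fun M cM hM τ hτ => ?_⟩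
  have hd : ∀ s, HasDerivAt (fun τ => ∫ s in (0 : ℝ)..τ, M s) (M s) s := fun s =>
    intervalIntegral.integral_hasDerivAt_right (cM.intervalIntegrable _ _)
      cM.stronglyMeasurable.stronglyMeasurableAtFilter cM.continuousAt
  have hd2 : ∀ s, HasDerivAt (fun τ => Real.exp (-(B * τ)) * (A + B * ∫ s in (0 : ℝ)..τ, M s))
      (Real.exp (-(B * s)) * B * (M s - (A + B * ∫ s in (0 : ℝ)..s, M s))) s := fun s => by
    have h1 : HasDerivAt (fun τ : ℝ => Real.exp (-(B * τ))) (Real.exp (-(B * s)) * (-(B * 1))) s :=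
      ((hasDerivAt_id s).const_mul B).neg.exp
    have := h1.mul (((hd s).const_mul B).const_add A)
    exact this.congr_deriv (by ring)
  have hanti : AntitoneOn (fun τ => Real.exp (-(B * τ)) * (A + B * ∫ s in (0 : ℝ)..τ, M s))
      (Icc 0 T) := by
    refine antitoneOn_of_deriv_nonpos (convex_Icc _ _)
      (fun s _ => (hd2 s).continuousAt.continuousWithinAt)
      (fun s _ => (hd2 s).differentiableAt.differentiableWithinAt) fun s hs => ?_
    rw [(hd2 s).deriv]
    rw [interior_Icc] at hs
    have := hM s (Ioo_subset_Icc_self hs)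
    exact mul_nonpos_of_nonneg_of_nonpos (by positivity) (by linarith)
  have h0 := hanti ⟨le_rfl, hτ.1.trans hτ.2⟩ hτ hτ.1
  simp only [mul_zero, neg_zero, Real.exp_zero, intervalIntegral.integral_same, add_zero,
    one_mul] at h0
  have h1 : A + B * ∫ s in (0 : ℝ)..τ, M s ≤ A * Real.exp (B * τ) := by
    rw [Real.exp_neg] at h0
    have := Real.exp_pos (B * τ)
    rw [inv_mul_le_iff₀ this] at h0
    linarith
  have h2 : A * Real.exp (B * τ) ≤ |A| * Real.exp (B * |T|) := by
    apply mul_le_mul (le_abs_self A) _ (Real.exp_pos _).le (abs_nonneg A)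
    exact Real.exp_le_exp.2 (mul_le_mul_of_nonneg_left (hτ.2.trans (le_abs_self T)) hB)
  linarith [hM τ hτ]

/-! ### Componentwise form of the system -/

/-- A solution of the MHD system in components, with all time slices defined on `ℝ` and the time
derivatives recorded on `[0, T]`. The spatial derivatives of the fluxes are expressed through the
equations. -/
structure MHDFlow (α β T : ℝ) where
  (v u θ w₁ w₂ b₁ b₂ : ℝ → ℝ → ℝ)
  (ux θx w₁x w₂x b₁x b₂x : ℝ → ℝ → ℝ)
  (ut θt w₁t w₂t b₁t b₂t : ℝ → ℝ → ℝ)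
  v_pos : ∀ x t, 0 < v x t
  θ_pos : ∀ x t, 0 < θ x t
  cv : Continuous fun p : ℝ × ℝ => v p.1 p.2
  cu : Continuous fun p : ℝ × ℝ => u p.1 p.2
  cθ : Continuous fun p : ℝ × ℝ => θ p.1 p.2
  cw₁ : Continuous fun p : ℝ × ℝ => w₁ p.1 p.2
  cw₂ : Continuous fun p : ℝ × ℝ => w₂ p.1 p.2
  cb₁ : Continuous fun p : ℝ × ℝ => b₁ p.1 p.2
  cb₂ : Continuous fun p : ℝ × ℝ => b₂ p.1 p.2
  cux : Continuous fun p : ℝ × ℝ => ux p.1 p.2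
  cθx : Continuous fun p : ℝ × ℝ => θx p.1 p.2
  cw₁x : Continuous fun p : ℝ × ℝ => w₁x p.1 p.2
  cw₂x : Continuous fun p : ℝ × ℝ => w₂x p.1 p.2
  cb₁x : Continuous fun p : ℝ × ℝ => b₁x p.1 p.2
  cb₂x : Continuous fun p : ℝ × ℝ => b₂x p.1 p.2
  cut : Continuous fun p : ℝ × ℝ => ut p.1 p.2
  cθt : Continuous fun p : ℝ × ℝ => θt p.1 p.2
  cw₁t : Continuous fun p : ℝ × ℝ => w₁t p.1 p.2
  cw₂t : Continuous fun p : ℝ × ℝ => w₂t p.1 p.2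
  cb₁t : Continuous fun p : ℝ × ℝ => b₁t p.1 p.2
  cb₂t : Continuous fun p : ℝ × ℝ => b₂t p.1 p.2
  u_dx : ∀ x t, HasDerivAt (fun y => u y t) (ux x t) x
  θ_dx : ∀ x t, HasDerivAt (fun y => θ y t) (θx x t) x
  w₁_dx : ∀ x t, HasDerivAt (fun y => w₁ y t) (w₁x x t) x
  w₂_dx : ∀ x t, HasDerivAt (fun y => w₂ y t) (w₂x x t) x
  b₁_dx : ∀ x t, HasDerivAt (fun y => b₁ y t) (b₁x x t) x
  b₂_dx : ∀ x t, HasDerivAt (fun y => b₂ y t) (b₂x x t) x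
  v_dt : ∀ x, ∀ t ∈ Icc 0 T, HasDerivWithinAt (fun s => v x s) (ux x t) (Icc 0 T) t
  u_dt : ∀ x, ∀ t ∈ Icc 0 T, HasDerivWithinAt (fun s => u x s) (ut x t) (Icc 0 T) t
  θ_dt : ∀ x, ∀ t ∈ Icc 0 T, HasDerivWithinAt (fun s => θ x s) (θt x t) (Icc 0 T) t
  w₁_dt : ∀ x, ∀ t ∈ Icc 0 T, HasDerivWithinAt (fun s => w₁ x s) (w₁t x t) (Icc 0 T) t
  w₂_dt : ∀ x, ∀ t ∈ Icc 0 T, HasDerivWithinAt (fun s => w₂ x s) (w₂t x t) (Icc 0 T) t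
  b₁_dt : ∀ x, ∀ t ∈ Icc 0 T, HasDerivWithinAt (fun s => b₁ x s) (b₁t x t) (Icc 0 T) t
  b₂_dt : ∀ x, ∀ t ∈ Icc 0 T, HasDerivWithinAt (fun s => b₂ x s) (b₂t x t) (Icc 0 T) t
  stress_dx : ∀ x, ∀ t ∈ Icc 0 T, HasDerivAt (fun y => visc α (v y t) * ux y t / v y t
    - (θ y t / v y t + (b₁ y t ^ 2 + b₂ y t ^ 2) / 2)) (ut x t) x
  heat_dx : ∀ x, ∀ t ∈ Icc 0 T, HasDerivAt (fun y => θ y t ^ β * θx y t / v y t)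
    (θt x t + θ x t / v x t * ux x t - (visc α (v x t) * ux x t ^ 2 + (w₁x x t ^ 2 + w₂x x t ^ 2)
      + (b₁x x t ^ 2 + b₂x x t ^ 2)) / v x t) x
  w₁_flux : ∀ x, ∀ t ∈ Icc 0 T, HasDerivAt (fun y => w₁x y t / v y t) (w₁t x t - b₁x x t) x
  w₂_flux : ∀ x, ∀ t ∈ Icc 0 T, HasDerivAt (fun y => w₂x y t / v y t) (w₂t x t - b₂x x t) x
  b₁_flux : ∀ x, ∀ t ∈ Icc 0 T, HasDerivAt (fun y => b₁x y t / v y t)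
    (ux x t * b₁ x t + v x t * b₁t x t - w₁x x t) x
  b₂_flux : ∀ x, ∀ t ∈ Icc 0 T, HasDerivAt (fun y => b₂x y t / v y t)
    (ux x t * b₂ x t + v x t * b₂t x t - w₂x x t) x
  v_far : Tendsto (fun p : ℝ × ℝ => v p.1 p.2) (comap (fun p => |p.1|) atTop) (nhds 1)
  u_far : Tendsto (fun p : ℝ × ℝ => u p.1 p.2) (comap (fun p => |p.1|) atTop) (nhds 0)
  θ_far : Tendsto (fun p : ℝ × ℝ => θ p.1 p.2) (comap (fun p => |p.1|) atTop) (nhds 1)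
  w₁_far : Tendsto (fun p : ℝ × ℝ => w₁ p.1 p.2) (comap (fun p => |p.1|) atTop) (nhds 0)
  w₂_far : Tendsto (fun p : ℝ × ℝ => w₂ p.1 p.2) (comap (fun p => |p.1|) atTop) (nhds 0)
  b₁_far : Tendsto (fun p : ℝ × ℝ => b₁ p.1 p.2) (comap (fun p => |p.1|) atTop) (nhds 0)
  b₂_far : Tendsto (fun p : ℝ × ℝ => b₂ p.1 p.2) (comap (fun p => |p.1|) atTop) (nhds 0)

lemma visc_ge_one {α z : ℝ} (hα : 0 ≤ α) (hz : 0 < z) : 1 ≤ visc α z := by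
  have : 0 ≤ α * z ^ (-α) := by positivity
  unfold visc
  linarith

namespace MHDFlow

variable {α β T : ℝ} (S : MHDFlow α β T)

lemma continuous_visc : Continuous fun p : ℝ × ℝ => visc α (S.v p.1 p.2) := by
  unfold visc
  exact continuous_const.add (continuous_const.mul
    (S.cv.rpow_const fun _ => Or.inl (S.v_pos _ _).ne'))

lemma continuous_θ_rpow (r : ℝ) : Continuous fun p : ℝ × ℝ => S.θ p.1 p.2 ^ r :=
  S.cθ.rpow_const fun _ => Or.inl (S.θ_pos _ _).ne'

lemma continuous_div_v {f : ℝ × ℝ → ℝ} (hf : Continuous f) :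
    Continuous fun p : ℝ × ℝ => f p / S.v p.1 p.2 :=
  hf.div S.cv fun _ => (S.v_pos _ _).ne'

lemma continuous_div_θ {f : ℝ × ℝ → ℝ} (hf : Continuous f) :
    Continuous fun p : ℝ × ℝ => f p / S.θ p.1 p.2 :=
  hf.div S.cθ fun _ => (S.θ_pos _ _).ne'

/-- Heating by viscosity and resistivity. -/
def heating (x t : ℝ) : ℝ :=
  (visc α (S.v x t) * S.ux x t ^ 2 + (S.w₁x x t ^ 2 + S.w₂x x t ^ 2)
    + (S.b₁x x t ^ 2 + S.b₂x x t ^ 2)) / S.v x t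

/-- Heat conduction `θ^β θ_x² / v`. -/
def conduction (x t : ℝ) : ℝ := S.θ x t ^ β * S.θx x t ^ 2 / S.v x t

/-- Entropy production. -/
def dissipation (x t : ℝ) : ℝ := S.heating x t / S.θ x t + S.conduction x t / S.θ x t / S.θ x t

/-- Relative entropy density with respect to the far-field state. -/
def entropy (x t : ℝ) : ℝ :=
  S.u x t ^ 2 / 2 + (S.v x t - 1 - Real.log (S.v x t)) + (S.θ x t - 1 - Real.log (S.θ x t))
    + (S.w₁ x t ^ 2 + S.w₂ x t ^ 2) / 2 + S.v x t * (S.b₁ x t ^ 2 + S.b₂ x t ^ 2) / 2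

/-- Time derivative of the relative entropy density. -/
def entropyRate (x t : ℝ) : ℝ :=
  S.u x t * S.ut x t + (1 - 1 / S.v x t) * S.ux x t + (1 - 1 / S.θ x t) * S.θt x t
    + (S.w₁ x t * S.w₁t x t + S.w₂ x t * S.w₂t x t)
    + (S.ux x t * (S.b₁ x t ^ 2 + S.b₂ x t ^ 2) / 2
      + S.v x t * (S.b₁ x t * S.b₁t x t + S.b₂ x t * S.b₂t x t))

/-- Convective part of the entropy flux. -/
def fluxConv (x t : ℝ) : ℝ :=
  S.u x t * (1 - (S.θ x t / S.v x t + (S.b₁ x t ^ 2 + S.b₂ x t ^ 2) / 2))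
    + (S.w₁ x t * S.b₁ x t + S.w₂ x t * S.b₂ x t)

/-- Diffusive part of the entropy flux. -/
def fluxDiff (x t : ℝ) : ℝ :=
  S.u x t * (visc α (S.v x t) * S.ux x t / S.v x t)
    + (1 - 1 / S.θ x t) * (S.θ x t ^ β * S.θx x t / S.v x t)
    + (S.w₁ x t * (S.w₁x x t / S.v x t) + S.w₂ x t * (S.w₂x x t / S.v x t))
    + (S.b₁ x t * (S.b₁x x t / S.v x t) + S.b₂ x t * (S.b₂x x t / S.v x t))

/-- Weight dominating the diffusive flux against the dissipation. -/
def fluxWeight (x t : ℝ) : ℝ :=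
  S.u x t ^ 2 * visc α (S.v x t) * S.θ x t / S.v x t
    + (1 - 1 / S.θ x t) ^ 2 * S.θ x t ^ β * S.θ x t ^ 2 / S.v x t
    + (S.w₁ x t ^ 2 + S.w₂ x t ^ 2 + S.b₁ x t ^ 2 + S.b₂ x t ^ 2) * S.θ x t / S.v x t

lemma continuous_heating : Continuous fun p : ℝ × ℝ => S.heating p.1 p.2 := by
  refine S.continuous_div_v ?_
  have := S.continuous_visc
  have := S.cux
  have := S.cw₁x
  have := S.cw₂x
  have := S.cb₁x
  have := S.cb₂x
  fun_prop

lemma continuous_conduction : Continuous fun p : ℝ × ℝ => S.conduction p.1 p.2 :=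
  S.continuous_div_v ((S.continuous_θ_rpow β).mul (S.cθx.pow 2))

lemma continuous_dissipation : Continuous fun p : ℝ × ℝ => S.dissipation p.1 p.2 :=
  (S.continuous_div_θ S.continuous_heating).add
    (S.continuous_div_θ (S.continuous_div_θ S.continuous_conduction))

lemma continuous_log_v : Continuous fun p : ℝ × ℝ => Real.log (S.v p.1 p.2) :=
  S.cv.log fun _ => (S.v_pos _ _).ne'

lemma continuous_log_θ : Continuous fun p : ℝ × ℝ => Real.log (S.θ p.1 p.2) :=
  S.cθ.log fun _ => (S.θ_pos _ _).ne'

lemma continuous_entropy : Continuous fun p : ℝ × ℝ => S.entropy p.1 p.2 := by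
  unfold entropy
  have := S.cv
  have := S.cu
  have := S.cθ
  have := S.cw₁
  have := S.cw₂
  have := S.cb₁
  have := S.cb₂
  have := S.continuous_log_v
  have := S.continuous_log_θ
  fun_prop

lemma continuous_entropyRate : Continuous fun p : ℝ × ℝ => S.entropyRate p.1 p.2 := by
  unfold entropyRate
  have := S.cv
  have := S.cu
  have := S.cw₁
  have := S.cw₂
  have := S.cb₁
  have := S.cb₂
  have := S.cut
  have := S.cux
  have := S.cθt
  have := S.cw₁t
  have := S.cw₂t
  have := S.cb₁t
  have := S.cb₂t
  have := S.continuous_div_v (f := fun _ => 1) continuous_const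
  have := S.continuous_div_θ (f := fun _ => 1) continuous_const
  fun_prop

lemma continuous_fluxConv : Continuous fun p : ℝ × ℝ => S.fluxConv p.1 p.2 := by
  unfold fluxConv
  have := S.cu
  have := S.cw₁
  have := S.cw₂
  have := S.cb₁
  have := S.cb₂
  have := S.continuous_div_v S.cθ
  fun_prop

lemma continuous_fluxDiff : Continuous fun p : ℝ × ℝ => S.fluxDiff p.1 p.2 := by
  unfold fluxDiff
  have := S.cu
  have := S.cw₁
  have := S.cw₂
  have := S.cb₁
  have := S.cb₂
  have := S.continuous_div_v (S.continuous_visc.mul S.cux)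
  have := S.continuous_div_v ((S.continuous_θ_rpow β).mul S.cθx)
  have := S.continuous_div_v S.cw₁x
  have := S.continuous_div_v S.cw₂x
  have := S.continuous_div_v S.cb₁x
  have := S.continuous_div_v S.cb₂x
  have := S.continuous_div_θ (f := fun _ => 1) continuous_const
  fun_prop

lemma continuous_fluxWeight : Continuous fun p : ℝ × ℝ => S.fluxWeight p.1 p.2 := by
  unfold fluxWeight
  have := S.cu
  have := S.cθ
  have := S.cw₁
  have := S.cw₂
  have := S.cb₁
  have := S.cb₂
  have := S.continuous_visc
  have := S.continuous_θ_rpow β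
  have := S.continuous_div_θ (f := fun _ => 1) continuous_const
  refine ((S.continuous_div_v ?_).add (S.continuous_div_v ?_)).add (S.continuous_div_v ?_) <;>
    fun_prop

lemma heating_nonneg (hα : 0 ≤ α) (x t : ℝ) : 0 ≤ S.heating x t := by
  have := S.v_pos x t
  have := visc_ge_one hα this
  unfold heating
  positivity

lemma conduction_nonneg (x t : ℝ) : 0 ≤ S.conduction x t := by
  have := S.v_pos x t
  have := S.θ_pos x t
  unfold conduction
  positivity

lemma dissipation_nonneg (hα : 0 ≤ α) (x t : ℝ) : 0 ≤ S.dissipation x t := by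
  have := S.θ_pos x t
  have := S.heating_nonneg hα x t
  have := S.conduction_nonneg x t
  unfold dissipation
  positivity

lemma entropy_v_nonneg (x t : ℝ) : 0 ≤ S.v x t - 1 - Real.log (S.v x t) := by
  linarith [Real.log_le_sub_one_of_pos (S.v_pos x t)]

lemma entropy_θ_nonneg (x t : ℝ) : 0 ≤ S.θ x t - 1 - Real.log (S.θ x t) := by
  linarith [Real.log_le_sub_one_of_pos (S.θ_pos x t)]

lemma entropy_nonneg (x t : ℝ) : 0 ≤ S.entropy x t := by
  have := S.v_pos x t
  have := S.entropy_v_nonneg x t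
  have := S.entropy_θ_nonneg x t
  unfold entropy
  positivity

lemma entropy_dt (x t : ℝ) (ht : t ∈ Icc 0 T) :
    HasDerivWithinAt (fun s => S.entropy x s) (S.entropyRate x t) (Icc 0 T) t := by
  have hv := (S.v_pos x t).ne'
  have hθ := (S.θ_pos x t).ne'
  have dv := S.v_dt x t ht
  have dθ := S.θ_dt x t ht
  have h := (((((S.u_dt x t ht).pow 2).div_const 2).add ((dv.sub_const 1).sub (dv.log hv))).add
    ((dθ.sub_const 1).sub (dθ.log hθ))).add
    ((((S.w₁_dt x t ht).pow 2).add ((S.w₂_dt x t ht).pow 2)).div_const 2)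
  have h' := h.add ((dv.mul (((S.b₁_dt x t ht).pow 2).add ((S.b₂_dt x t ht).pow 2))).div_const 2)
  refine h'.congr_deriv ?_
  unfold entropyRate
  simp
  ring

lemma flux_dx (x t : ℝ) (ht : t ∈ Icc 0 T) :
    HasDerivAt (fun y => S.fluxConv y t + S.fluxDiff y t)
      (S.entropyRate x t + S.dissipation x t) x := by
  have hv := (S.v_pos x t).ne'
  have hθ := (S.θ_pos x t).ne'
  have h1 := (S.u_dx x t).mul ((S.stress_dx x t ht).add_const 1)
  have h2 := (((S.θ_dx x t).inv hθ).const_sub 1).mul (S.heat_dx x t ht)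
  have h3 := ((S.w₁_dx x t).mul (S.w₁_flux x t ht)).add ((S.w₂_dx x t).mul (S.w₂_flux x t ht))
  have h4 := ((S.b₁_dx x t).mul (S.b₁_flux x t ht)).add ((S.b₂_dx x t).mul (S.b₂_flux x t ht))
  have h5 := ((S.w₁_dx x t).mul (S.b₁_dx x t)).add ((S.w₂_dx x t).mul (S.b₂_dx x t))
  have h := ((((h1.add h2).add h3).add h4).add h5)
  refine (h.congr_deriv ?_).congr_of_eventuallyEq (Eventually.of_forall fun y => ?_)
  · unfold entropyRate dissipation heating conduction
    simp
    field_simp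
    ring
  · unfold fluxConv fluxDiff
    simp
    ring

end MHDFlow

/-! ### The entropy inequality -/

lemma exists_bound_of_tendsto_far {T : ℝ} {f : ℝ → ℝ → ℝ}
    (cf : Continuous fun p : ℝ × ℝ => f p.1 p.2)
    (hf : Tendsto (fun p : ℝ × ℝ => f p.1 p.2) (comap (fun p => |p.1|) atTop) (nhds 0))
    {ε : ℝ} (hε : 0 < ε) :
    ∃ B : ℝ, 0 ≤ B ∧ ∀ x, ∀ t ∈ Icc 0 T, |f x t| ≤ ε + B / (1 + x ^ 2) := by
  have h1 := (Metric.tendsto_nhds.1 hf) ε hε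
  rw [eventually_comap] at h1
  obtain ⟨M, hM⟩ := eventually_atTop.1 h1
  obtain ⟨C, hC⟩ := ((isCompact_Icc (a := -M) (b := M)).prod
    (isCompact_Icc (a := 0) (b := T))).exists_bound_of_continuousOn cf.continuousOn
  refine ⟨|C| * (1 + M ^ 2), by positivity, fun x t ht => ?_⟩
  rcases le_or_gt M |x| with h | h
  · have := hM |x| h (x, t) rfl
    rw [Real.dist_eq, sub_zero] at this
    have h2 : 0 ≤ |C| * (1 + M ^ 2) / (1 + x ^ 2) := by positivity
    simp only at this
    linarith
  · have h2 : |f x t| ≤ |C| := (hC (x, t) ⟨abs_le.1 h.le, ht⟩).trans (le_abs_self C)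
    have h3 : |C| ≤ |C| * (1 + M ^ 2) / (1 + x ^ 2) := by
      rw [le_div_iff₀ (by positivity)]
      have : x ^ 2 ≤ M ^ 2 := sq_le_sq.2 (h.le.trans (le_abs_self M))
      exact mul_le_mul_of_nonneg_left (by linarith) (abs_nonneg C)
    linarith

namespace MHDFlow

variable {α β T : ℝ} (S : MHDFlow α β T)

lemma fluxConv_far :
    Tendsto (fun p : ℝ × ℝ => S.fluxConv p.1 p.2) (comap (fun p => |p.1|) atTop) (nhds 0) := by
  have h := (S.u_far.mul (((S.θ_far.div S.v_far one_ne_zero).add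
    (((S.b₁_far.pow 2).add (S.b₂_far.pow 2)).div_const 2)).const_sub 1)).add
    ((S.w₁_far.mul S.b₁_far).add (S.w₂_far.mul S.b₂_far))
  simpa [fluxConv] using h

lemma fluxWeight_far :
    Tendsto (fun p : ℝ × ℝ => S.fluxWeight p.1 p.2) (comap (fun p => |p.1|) atTop) (nhds 0) := by
  have hμ : Tendsto (fun p : ℝ × ℝ => visc α (S.v p.1 p.2)) (comap (fun p => |p.1|) atTop)
      (nhds (visc α 1)) :=
    ((S.v_far.rpow_const (Or.inl one_ne_zero)).const_mul α).const_add 1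
  have hβ : Tendsto (fun p : ℝ × ℝ => S.θ p.1 p.2 ^ β) (comap (fun p => |p.1|) atTop)
      (nhds (1 ^ β)) := S.θ_far.rpow_const (Or.inl one_ne_zero)
  have h := (((((S.u_far.pow 2).mul hμ).mul S.θ_far).div S.v_far one_ne_zero).add
    ((((((S.θ_far.inv₀ one_ne_zero).const_sub 1).pow 2).mul hβ).mul (S.θ_far.pow 2)).div
      S.v_far one_ne_zero)).add
    ((((((S.w₁_far.pow 2).add (S.w₂_far.pow 2)).add (S.b₁_far.pow 2)).add (S.b₂_far.pow 2)).mul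
      S.θ_far).div S.v_far one_ne_zero)
  simpa [fluxWeight] using h

lemma neg_fluxDiff_le (hα : 0 ≤ α) (a c x t : ℝ) :
    -(2 * a * c * S.fluxDiff x t)
      ≤ 1 / 2 * (a ^ 2 * S.dissipation x t) + 2 * c ^ 2 * S.fluxWeight x t := by
  have hv := S.v_pos x t
  have hθ := S.θ_pos x t
  have hμ := visc_ge_one hα hv
  have key : 1 / 2 * (a ^ 2 * S.dissipation x t) + 2 * c ^ 2 * S.fluxWeight x t
      + 2 * a * c * S.fluxDiff x t
      = visc α (S.v x t) / (2 * S.v x t * S.θ x t)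
          * (a * S.ux x t + 2 * c * S.u x t * S.θ x t) ^ 2
        + S.θ x t ^ β / (2 * S.v x t * S.θ x t ^ 2)
          * (a * S.θx x t + 2 * c * (1 - 1 / S.θ x t) * S.θ x t ^ 2) ^ 2
        + 1 / (2 * S.v x t * S.θ x t)
          * ((a * S.w₁x x t + 2 * c * S.w₁ x t * S.θ x t) ^ 2
            + (a * S.w₂x x t + 2 * c * S.w₂ x t * S.θ x t) ^ 2
            + (a * S.b₁x x t + 2 * c * S.b₁ x t * S.θ x t) ^ 2
            + (a * S.b₂x x t + 2 * c * S.b₂ x t * S.θ x t) ^ 2) := by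
    unfold dissipation heating conduction fluxWeight fluxDiff
    field_simp
    ring
  have : 0 ≤ 1 / 2 * (a ^ 2 * S.dissipation x t) + 2 * c ^ 2 * S.fluxWeight x t
      + 2 * a * c * S.fluxDiff x t := by
    rw [key]
    positivity
  linarith

/-- Localized entropy inequality with the cut-off `(1 - (x/R)²)²`. -/
lemma localized_entropy_le (hα : 0 ≤ α) {R τ ε B K : ℝ} (hR : 0 < R) (hτ : τ ∈ Icc 0 T)
    (hB0 : 0 ≤ B)
    (hB : ∀ x, ∀ t ∈ Icc 0 T, |S.fluxConv x t| ≤ ε + B / (1 + x ^ 2))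
    (hK : ∀ x, ∀ t ∈ Icc 0 T, |S.fluxWeight x t| ≤ K) :
    (∫ x in -R..R, (1 - (x / R) ^ 2) ^ 2 * S.entropy x τ)
      + 1 / 2 * rectInt (-R) R τ (fun x t => (1 - (x / R) ^ 2) ^ 2 * S.dissipation x t)
      ≤ (∫ x in -R..R, (1 - (x / R) ^ 2) ^ 2 * S.entropy x 0)
        + τ * (8 * ε + 4 * Real.pi * B / R + 16 * K / R) := by
  have cφ : Continuous fun p : ℝ × ℝ => (1 - (p.1 / R) ^ 2) ^ 2 := by fun_prop
  have cφ' : Continuous fun p : ℝ × ℝ => 2 * (1 - (p.1 / R) ^ 2) * (-(2 * p.1 / R ^ 2)) := by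
    fun_prop
  have dφ : ∀ x : ℝ, HasDerivAt (fun y : ℝ => (1 - (y / R) ^ 2) ^ 2)
      (2 * (1 - (x / R) ^ 2) * (-(2 * x / R ^ 2))) x := fun x => by
    refine (((((hasDerivAt_id x).div_const R).pow 2).const_sub 1).pow 2).congr_deriv ?_
    simp only [id, Nat.cast_ofNat, Nat.add_one_sub_one, pow_one, Pi.pow_apply]
    ring
  have cS : Continuous fun p : ℝ × ℝ => (1 - (p.1 / R) ^ 2) ^ 2 * S.dissipation p.1 p.2
      + 2 * (1 - (p.1 / R) ^ 2) * (-(2 * p.1 / R ^ 2))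
        * (S.fluxConv p.1 p.2 + S.fluxDiff p.1 p.2) :=
    (cφ.mul S.continuous_dissipation).add (cφ'.mul (S.continuous_fluxConv.add S.continuous_fluxDiff))
  have hbal := integral_sub_eq_of_balance (a := -R) (b := R) hτ
    (E := fun x t => (1 - (x / R) ^ 2) ^ 2 * S.entropy x t)
    (Et := fun x t => (1 - (x / R) ^ 2) ^ 2 * S.entropyRate x t)
    (J := fun x t => (1 - (x / R) ^ 2) ^ 2 * (S.fluxConv x t + S.fluxDiff x t))
    (S := fun x t => (1 - (x / R) ^ 2) ^ 2 * S.dissipation x t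
      + 2 * (1 - (x / R) ^ 2) * (-(2 * x / R ^ 2)) * (S.fluxConv x t + S.fluxDiff x t))
    (fun x t ht => (S.entropy_dt x t ht).const_mul _)
    (fun x t ht => ((dφ x).mul (S.flux_dx x t ht)).congr_deriv (by ring))
    (cφ.mul S.continuous_entropy) (cφ.mul S.continuous_entropyRate) cS
  have hRR : R / R = 1 := div_self hR.ne'
  have hRR' : -R / R = -1 := by rw [neg_div, hRR]
  simp only [hRR, hRR', one_pow, neg_sq, sub_self, ne_eq, OfNat.ofNat_ne_zero, not_false_eq_true,
    zero_pow, zero_mul, zero_sub, intervalIntegral.integral_neg] at hbal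
  have hpt : ∀ x ∈ Icc (-R) R, ∀ t ∈ Icc 0 τ,
      1 / 2 * ((1 - (x / R) ^ 2) ^ 2 * S.dissipation x t)
      ≤ ((1 - (x / R) ^ 2) ^ 2 * S.dissipation x t
        + 2 * (1 - (x / R) ^ 2) * (-(2 * x / R ^ 2)) * (S.fluxConv x t + S.fluxDiff x t))
        + (4 / R * (ε + B / (1 + x ^ 2)) + 8 / R ^ 2 * K) := by
    intro x hx t ht
    have ht' : t ∈ Icc 0 T := ⟨ht.1, ht.2.trans hτ.2⟩
    have h1 := S.neg_fluxDiff_le hα (1 - (x / R) ^ 2) (-(2 * x / R ^ 2)) x t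
    have hxR : |x| ≤ R := abs_le.2 hx
    have hψ : |1 - (x / R) ^ 2| ≤ 1 := by
      have h2 : (x / R) ^ 2 ≤ 1 := by
        rw [div_pow, div_le_one (by positivity)]
        exact sq_le_sq.2 (by rwa [abs_of_pos hR])
      rw [abs_le]
      constructor <;> nlinarith [sq_nonneg (x / R)]
    have hψ' : |-(2 * x / R ^ 2)| ≤ 2 / R := by
      rw [abs_neg, abs_div, abs_mul, abs_of_pos (by positivity : (0 : ℝ) < R ^ 2), abs_two,
        div_le_div_iff₀ (by positivity) hR]
      nlinarith
    have h2 : |2 * (1 - (x / R) ^ 2) * (-(2 * x / R ^ 2)) * S.fluxConv x t|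
        ≤ 4 / R * (ε + B / (1 + x ^ 2)) := by
      rw [abs_mul, abs_mul, abs_mul, abs_two]
      have h3 : 2 * |1 - (x / R) ^ 2| * |-(2 * x / R ^ 2)| ≤ 2 * 1 * (2 / R) := by gcongr
      calc _ ≤ 2 * 1 * (2 / R) * (ε + B / (1 + x ^ 2)) := by
            gcongr
            exact hB x t ht'
        _ = _ := by ring
    have h4 : 2 * (-(2 * x / R ^ 2)) ^ 2 * S.fluxWeight x t ≤ 8 / R ^ 2 * K := by
      have h5 : (-(2 * x / R ^ 2)) ^ 2 ≤ (2 / R) ^ 2 := by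
        rw [← sq_abs]
        gcongr
      calc _ ≤ 2 * (-(2 * x / R ^ 2)) ^ 2 * K := by
            gcongr
            exact (le_abs_self _).trans (hK x t ht')
        _ ≤ 2 * (2 / R) ^ 2 * K := by
            have : 0 ≤ K := (abs_nonneg _).trans (hK x t ht')
            gcongr
        _ = _ := by ring
    have h6 := neg_abs_le (2 * (1 - (x / R) ^ 2) * (-(2 * x / R ^ 2)) * S.fluxConv x t)
    linarith
  have cerr : Continuous fun p : ℝ × ℝ => 4 / R * (ε + B / (1 + p.1 ^ 2)) + 8 / R ^ 2 * K := by
    have : Continuous fun p : ℝ × ℝ => B / (1 + p.1 ^ 2) :=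
      continuous_const.div (by fun_prop) fun p => by positivity
    fun_prop
  have hmono := rectInt_mono (by linarith : -R ≤ R) hτ.1
    (f := fun x t => 1 / 2 * ((1 - (x / R) ^ 2) ^ 2 * S.dissipation x t))
    (continuous_const.mul (cφ.mul S.continuous_dissipation)) (cS.add cerr) hpt
  rw [rectInt_const_mul, rectInt_add cS cerr] at hmono
  have herr : rectInt (-R) R τ (fun x _ => 4 / R * (ε + B / (1 + x ^ 2)) + 8 / R ^ 2 * K)
      ≤ τ * (8 * ε + 4 * Real.pi * B / R + 16 * K / R) := by
    have hi : ∫ x in -R..R, (4 / R * (ε + B / (1 + x ^ 2)) + 8 / R ^ 2 * K)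
        = 8 * ε + 4 * B / R * (Real.arctan R - Real.arctan (-R)) + 16 * K / R := by
      have h1 : ∀ x : ℝ, 4 / R * (ε + B / (1 + x ^ 2)) + 8 / R ^ 2 * K
          = (4 / R * ε + 8 / R ^ 2 * K) + 4 * B / R * (1 + x ^ 2)⁻¹ := fun x => by
        rw [div_eq_mul_inv B]
        ring
      simp_rw [h1]
      rw [intervalIntegral.integral_add (by simp) ((integrable_inv_one_add_sq.const_mul
        _).intervalIntegrable), intervalIntegral.integral_const_mul, integral_inv_one_add_sq,
        intervalIntegral.integral_const, smul_eq_mul]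
      field_simp
      ring
    unfold rectInt
    simp only
    rw [hi, intervalIntegral.integral_const, smul_eq_mul, sub_zero]
    refine mul_le_mul_of_nonneg_left ?_ hτ.1
    have h2 : 4 * B / R * (Real.arctan R - Real.arctan (-R)) ≤ 4 * B / R * Real.pi := by
      refine mul_le_mul_of_nonneg_left ?_ (by positivity)
      linarith [Real.arctan_lt_pi_div_two R, Real.neg_pi_div_two_lt_arctan (-R)]
    have h3 : 4 * B / R * Real.pi = 4 * Real.pi * B / R := by ring
    linarith
  unfold rectInt at *
  linarith

/-- The global entropy inequality, on symmetric windows. -/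
theorem entropy_window_le (hα : 0 ≤ α) (hT : 0 < T) {E₀ : ℝ}
    (h0 : ∀ N : ℝ, 0 ≤ N → ∫ x in -N..N, S.entropy x 0 ≤ E₀) {N τ : ℝ} (hN : 0 ≤ N)
    (hτ : τ ∈ Icc 0 T) :
    (∫ x in -N..N, S.entropy x τ) + rectInt (-N) N τ S.dissipation ≤ 4 * (E₀ + 1) := by
  obtain ⟨B, hB0, hB⟩ := exists_bound_of_tendsto_far (T := T) S.continuous_fluxConv
    S.fluxConv_far (ε := 1 / (16 * T)) (by positivity)
  obtain ⟨K, hK0, hK⟩ := exists_bound_of_tendsto_far (T := T) S.continuous_fluxWeight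
    S.fluxWeight_far one_pos
  have hK' : ∀ x, ∀ t ∈ Icc 0 T, |S.fluxWeight x t| ≤ 1 + K := fun x t ht => by
    refine (hK x t ht).trans ?_
    gcongr
    exact div_le_self hK0 (by nlinarith [sq_nonneg x])
  have hπ := Real.pi_pos
  set A := 4 * Real.pi * B + 16 * (1 + K) with hA
  have hA0 : 0 ≤ A := by positivity
  set R := 2 * N + 1 + 2 * T * A with hRdef
  have hR : 0 < R := by positivity
  have hTA : 0 ≤ 2 * T * A := by positivity
  have hNR : 2 * N ≤ R := by linarith
  have hmain := S.localized_entropy_le hα hR hτ hB0 hB hK'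
  have herr : τ * (8 * (1 / (16 * T)) + 4 * Real.pi * B / R + 16 * (1 + K) / R) ≤ 1 := by
    have h1 : 4 * Real.pi * B / R + 16 * (1 + K) / R = A / R := by rw [hA]; ring
    have h2 : T * (A / R) ≤ 1 / 2 := by
      rw [← mul_div_assoc, div_le_iff₀ hR]
      linarith
    have h3 : T * (8 * (1 / (16 * T))) = 1 / 2 := by field_simp; norm_num
    have h4 : 0 ≤ A / R := by positivity
    calc _ = τ * (8 * (1 / (16 * T)) + A / R) := by rw [← h1]; ring
      _ ≤ T * (8 * (1 / (16 * T)) + A / R) := mul_le_mul_of_nonneg_right hτ.2 (by positivity)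
      _ ≤ 1 := by rw [mul_add]; linarith
  have cφ : Continuous fun p : ℝ × ℝ => (1 - (p.1 / R) ^ 2) ^ 2 := by fun_prop
  have cφE : ∀ t, Continuous fun x : ℝ => (1 - (x / R) ^ 2) ^ 2 * S.entropy x t := fun t =>
    Continuous.mul (by fun_prop) (continuous_slice_left S.continuous_entropy t)
  have hφ1 : ∀ x ∈ Icc (-R) R, (1 - (x / R) ^ 2) ^ 2 ≤ 1 := fun x hx => by
    have h2 : (x / R) ^ 2 ≤ 1 := by
      rw [div_pow, div_le_one (by positivity)]
      exact sq_le_sq.2 (by rw [abs_of_pos hR]; exact abs_le.2 hx)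
    have := sq_nonneg (x / R)
    nlinarith
  have hφ2 : ∀ x ∈ Icc (-N) N, 1 / 2 ≤ (1 - (x / R) ^ 2) ^ 2 := fun x hx => by
    have h2 : (x / R) ^ 2 ≤ 1 / 4 := by
      rw [div_pow, div_le_iff₀ (by positivity)]
      have : |x| ≤ N := abs_le.2 hx
      have h3 : x ^ 2 ≤ N ^ 2 := sq_le_sq.2 (by rwa [abs_of_nonneg hN])
      nlinarith
    nlinarith [sq_nonneg (x / R)]
  have hinit : ∫ x in -R..R, (1 - (x / R) ^ 2) ^ 2 * S.entropy x 0 ≤ E₀ := by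
    refine le_trans (intervalIntegral.integral_mono_on (by linarith)
      ((cφE 0).intervalIntegrable _ _)
      ((continuous_slice_left S.continuous_entropy 0).intervalIntegrable _ _) fun x hx => ?_)
      (h0 R hR.le)
    exact mul_le_of_le_one_left (S.entropy_nonneg x 0) (hφ1 x hx)
  have hE : 1 / 2 * (∫ x in -N..N, S.entropy x τ)
      ≤ ∫ x in -R..R, (1 - (x / R) ^ 2) ^ 2 * S.entropy x τ := by
    rw [← intervalIntegral.integral_const_mul]
    refine le_trans (intervalIntegral.integral_mono_on (by linarith)
      (((continuous_slice_left S.continuous_entropy τ).const_mul _).intervalIntegrable _ _)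
      ((cφE τ).intervalIntegrable _ _)
      fun x hx => ?_) (integral_le_of_subinterval (cφE τ)
        (fun x => mul_nonneg (sq_nonneg _) (S.entropy_nonneg x τ)) (by linarith : -R ≤ -N)
        (by linarith) (by linarith))
    exact mul_le_mul_of_nonneg_right (hφ2 x hx) (S.entropy_nonneg x τ)
  have hD : 1 / 2 * rectInt (-N) N τ S.dissipation
      ≤ rectInt (-R) R τ (fun x t => (1 - (x / R) ^ 2) ^ 2 * S.dissipation x t) := by
    rw [← rectInt_const_mul]
    refine le_trans (rectInt_mono (by linarith) hτ.1
      (continuous_const.mul S.continuous_dissipation) (cφ.mul S.continuous_dissipation)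
      fun x hx t _ => ?_) (rectInt_le_of_subinterval hτ.1
        (f := fun x t => (1 - (x / R) ^ 2) ^ 2 * S.dissipation x t)
        (cφ.mul S.continuous_dissipation)
        (fun x t => mul_nonneg (sq_nonneg _) (S.dissipation_nonneg hα x t))
        (by linarith : -R ≤ -N) (by linarith) (by linarith))
    exact mul_le_mul_of_nonneg_right (hφ2 x hx) (S.dissipation_nonneg hα x t)
  have hpos : 0 ≤ ∫ x in -N..N, S.entropy x τ :=
    intervalIntegral.integral_nonneg (by linarith) fun x _ => S.entropy_nonneg x τ
  linarith

end MHDFlow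

/-! ### Lower bound for the specific volume -/

/-- Primitive of `visc α z / z`. -/
def viscPrim (α z : ℝ) : ℝ := Real.log z - z ^ (-α)

lemma viscPrim_hasDerivAt (α : ℝ) {z : ℝ} (hz : 0 < z) :
    HasDerivAt (viscPrim α) (visc α z / z) z := by
  refine ((Real.hasDerivAt_log hz.ne').sub
    (Real.hasDerivAt_rpow_const (p := -α) (Or.inl hz.ne'))).congr_deriv ?_
  rw [Real.rpow_sub_one hz.ne']
  unfold visc
  field_simp
  ring

lemma viscPrim_mono {α y z : ℝ} (hα : 0 ≤ α) (hy : 0 < y) (hyz : y ≤ z) :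
    viscPrim α y ≤ viscPrim α z := by
  have h1 := Real.log_le_log hy hyz
  have h2 := Real.rpow_le_rpow_of_nonpos hy hyz (neg_nonpos.2 hα)
  unfold viscPrim
  linarith

lemma exp_viscPrim_le {α z : ℝ} (hz : 0 < z) : Real.exp (viscPrim α z) ≤ z := by
  have h := Real.rpow_pos_of_pos hz (-α)
  calc Real.exp (viscPrim α z) ≤ Real.exp (Real.log z) :=
        Real.exp_le_exp.2 (by unfold viscPrim; linarith)
    _ = z := Real.exp_log hz

/-- `exp (viscPrim α z)` dominates an affine function of the relative entropy of `z`. -/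
lemma le_exp_viscPrim {α η z : ℝ} (hα : 0 ≤ α) (hη : 0 < η) (hz : 0 < z) :
    Real.exp (viscPrim α (Real.exp (-1 - 1 / η))) * (1 - η * (z - 1 - Real.log z))
      ≤ Real.exp (viscPrim α z) := by
  have he : 0 ≤ z - 1 - Real.log z := by linarith [Real.log_le_sub_one_of_pos hz]
  rcases le_or_gt (1 - η * (z - 1 - Real.log z)) 0 with h | h
  · exact (mul_nonpos_of_nonneg_of_nonpos (Real.exp_pos _).le h).trans (Real.exp_pos _).le
  · have h1 : z - 1 - Real.log z < 1 / η := by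
      rw [lt_div_iff₀ hη]
      linarith
    have h2 : Real.exp (-1 - 1 / η) ≤ z := by
      rw [← Real.le_log_iff_exp_le hz]
      linarith
    calc _ ≤ Real.exp (viscPrim α (Real.exp (-1 - 1 / η))) * 1 := by
          gcongr
          have := mul_nonneg hη.le he
          linarith
      _ ≤ _ := by
          rw [mul_one]
          exact Real.exp_le_exp.2 (viscPrim_mono hα (Real.exp_pos _) h2)

lemma le_two_mul_sub_log_add_two {z : ℝ} (hz : 0 < z) : z ≤ 2 * (z - 1 - Real.log z) + 2 := by
  have h1 := Real.log_le_sub_one_of_pos (half_pos hz)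
  rw [Real.log_div hz.ne' two_ne_zero] at h1
  have h2 := Real.log_two_lt_d9
  linarith

namespace MHDFlow

variable {α β T : ℝ} (S : MHDFlow α β T)

/-- Bounds on the initial volume together with the entropy inequality. -/
structure Controlled (δ V₀ C : ℝ) : Prop where
  le_v₀ : ∀ x, δ ≤ S.v x 0
  v₀_le : ∀ x, S.v x 0 ≤ V₀
  window_le : ∀ N τ : ℝ, 0 ≤ N → τ ∈ Icc 0 T →
    (∫ x in -N..N, S.entropy x τ) + rectInt (-N) N τ S.dissipation ≤ C

variable {S} {δ V₀ C : ℝ}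

lemma Controlled.entropy_le (h : S.Controlled δ V₀ C) (hα : 0 ≤ α) {N τ : ℝ} (hN : 0 ≤ N)
    (hτ : τ ∈ Icc 0 T) : ∫ x in -N..N, S.entropy x τ ≤ C := by
  have h1 := h.window_le N τ hN hτ
  have h2 := rectInt_nonneg (by linarith : -N ≤ N) hτ.1
    fun x _ t _ => S.dissipation_nonneg hα x t
  linarith

lemma Controlled.dissipation_le (h : S.Controlled δ V₀ C) {N τ : ℝ} (hN : 0 ≤ N)
    (hτ : τ ∈ Icc 0 T) : rectInt (-N) N τ S.dissipation ≤ C := by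
  have h1 := h.window_le N τ hN hτ
  have h2 := intervalIntegral.integral_nonneg (μ := volume) (by linarith : -N ≤ N)
    fun x _ => S.entropy_nonneg x τ
  linarith

lemma exists_window (a : ℝ) : ∃ N : ℝ, 0 ≤ N ∧ -N ≤ a ∧ a + 1 ≤ N :=
  ⟨|a| + 1, by positivity, by linarith [neg_abs_le a], by linarith [le_abs_self a]⟩

lemma Controlled.entropy_unit_le (h : S.Controlled δ V₀ C) (hα : 0 ≤ α) (a : ℝ) {τ : ℝ}
    (hτ : τ ∈ Icc 0 T) : ∫ x in a..a + 1, S.entropy x τ ≤ C := by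
  obtain ⟨N, h0, h1, h2⟩ := exists_window a
  exact (integral_le_of_subinterval (continuous_slice_left S.continuous_entropy τ)
    (fun x => S.entropy_nonneg x τ) h1 (by linarith) h2).trans (h.entropy_le hα h0 hτ)

lemma Controlled.dissipation_unit_le (h : S.Controlled δ V₀ C) (hα : 0 ≤ α) (a : ℝ) {τ : ℝ}
    (hτ : τ ∈ Icc 0 T) : rectInt a (a + 1) τ S.dissipation ≤ C := by
  obtain ⟨N, h0, h1, h2⟩ := exists_window a
  exact (rectInt_le_of_subinterval hτ.1 S.continuous_dissipation (S.dissipation_nonneg hα) h1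
    (by linarith) h2).trans (h.dissipation_le h0 hτ)

/-- A function bounded by an affine function of the entropy has bounded mean on unit intervals. -/
lemma Controlled.integral_unit_le (h : S.Controlled δ V₀ C) (hα : 0 ≤ α) (a : ℝ) {τ : ℝ}
    (hτ : τ ∈ Icc 0 T) {f : ℝ → ℝ} (cf : Continuous f) {A B : ℝ} (hA : 0 ≤ A)
    (hf : ∀ x, f x ≤ A * S.entropy x τ + B) : ∫ x in a..a + 1, f x ≤ A * C + B := by
  have cE := continuous_slice_left S.continuous_entropy τ
  have h1 := intervalIntegral.integral_mono_on (μ := volume) (by linarith : a ≤ a + 1)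
    (cf.intervalIntegrable _ _)
    (g := fun x => A * S.entropy x τ + B)
    (((cE.const_mul A).add continuous_const).intervalIntegrable _ _) fun x _ => hf x
  rw [intervalIntegral.integral_add ((cE.const_mul A).intervalIntegrable _ _) (by simp),
    intervalIntegral.integral_const_mul] at h1
  simp only [intervalIntegral.integral_const, add_sub_cancel_left, smul_eq_mul, one_mul] at h1
  have h2 := mul_le_mul_of_nonneg_left (h.entropy_unit_le hα a hτ) hA
  linarith

variable (S)

lemma v_le_entropy (x t : ℝ) : S.v x t ≤ 2 * S.entropy x t + 2 := by
  have h1 := le_two_mul_sub_log_add_two (S.v_pos x t)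
  have h2 := S.entropy_θ_nonneg x t
  have h3 : 0 ≤ S.v x t * (S.b₁ x t ^ 2 + S.b₂ x t ^ 2) / 2 := by
    have := S.v_pos x t
    positivity
  unfold entropy
  nlinarith [sq_nonneg (S.u x t), sq_nonneg (S.w₁ x t), sq_nonneg (S.w₂ x t)]

lemma θ_le_entropy (x t : ℝ) : S.θ x t ≤ 2 * S.entropy x t + 2 := by
  have h1 := le_two_mul_sub_log_add_two (S.θ_pos x t)
  have h2 := S.entropy_v_nonneg x t
  have h3 : 0 ≤ S.v x t * (S.b₁ x t ^ 2 + S.b₂ x t ^ 2) / 2 := by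
    have := S.v_pos x t
    positivity
  unfold entropy
  nlinarith [sq_nonneg (S.u x t), sq_nonneg (S.w₁ x t), sq_nonneg (S.w₂ x t)]

lemma vb_le_entropy (x t : ℝ) :
    S.v x t * (S.b₁ x t ^ 2 + S.b₂ x t ^ 2) / 2 ≤ S.entropy x t := by
  have h1 := S.entropy_θ_nonneg x t
  have h2 := S.entropy_v_nonneg x t
  unfold entropy
  nlinarith [sq_nonneg (S.u x t), sq_nonneg (S.w₁ x t), sq_nonneg (S.w₂ x t)]

lemma u_sq_le_entropy (x t : ℝ) : S.u x t ^ 2 / 2 ≤ S.entropy x t := by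
  have h1 := S.entropy_θ_nonneg x t
  have h2 := S.entropy_v_nonneg x t
  have h3 : 0 ≤ S.v x t * (S.b₁ x t ^ 2 + S.b₂ x t ^ 2) / 2 := by
    have := S.v_pos x t
    positivity
  unfold entropy
  nlinarith [sq_nonneg (S.u x t), sq_nonneg (S.w₁ x t), sq_nonneg (S.w₂ x t)]

lemma entropy_v_le_entropy (x t : ℝ) : S.v x t - 1 - Real.log (S.v x t) ≤ S.entropy x t := by
  have h1 := S.entropy_θ_nonneg x t
  have h3 : 0 ≤ S.v x t * (S.b₁ x t ^ 2 + S.b₂ x t ^ 2) / 2 := by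
    have := S.v_pos x t
    positivity
  unfold entropy
  nlinarith [sq_nonneg (S.u x t), sq_nonneg (S.w₁ x t), sq_nonneg (S.w₂ x t)]

/-- Total (gas and magnetic) pressure. -/
def pressure (x t : ℝ) : ℝ := S.θ x t / S.v x t + (S.b₁ x t ^ 2 + S.b₂ x t ^ 2) / 2

lemma continuous_pressure : Continuous fun p : ℝ × ℝ => S.pressure p.1 p.2 :=
  (S.continuous_div_v S.cθ).add (((S.cb₁.pow 2).add (S.cb₂.pow 2)).div_const 2)

lemma pressure_nonneg (x t : ℝ) : 0 ≤ S.pressure x t := by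
  have := S.v_pos x t
  have := S.θ_pos x t
  unfold pressure
  positivity

lemma pressure_mul_v_le (x t : ℝ) : S.pressure x t * S.v x t ≤ 3 * S.entropy x t + 2 := by
  have h1 := S.θ_le_entropy x t
  have h2 := S.vb_le_entropy x t
  have h3 : S.pressure x t * S.v x t
      = S.θ x t + S.v x t * (S.b₁ x t ^ 2 + S.b₂ x t ^ 2) / 2 := by
    have := (S.v_pos x t).ne'
    unfold pressure
    field_simp
  linarith

/-- Time-integrated stress. -/
def impulse (x τ : ℝ) : ℝ :=
  viscPrim α (S.v x τ) - viscPrim α (S.v x 0) - ∫ s in (0 : ℝ)..τ, S.pressure x s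

lemma continuous_viscPrim : Continuous fun p : ℝ × ℝ => viscPrim α (S.v p.1 p.2) :=
  S.continuous_log_v.sub (S.cv.rpow_const fun _ => Or.inl (S.v_pos _ _).ne')

lemma impulse_sub (a x : ℝ) {τ : ℝ} (hτ : τ ∈ Icc 0 T) :
    S.impulse x τ - S.impulse a τ = (∫ y in a..x, S.u y τ) - ∫ y in a..x, S.u y 0 := by
  have cσ : ∀ z, Continuous fun t => visc α (S.v z t) * S.ux z t / S.v z t := fun z =>
    continuous_slice_right (f := fun x t => visc α (S.v x t) * S.ux x t / S.v x t)
      (S.continuous_div_v (S.continuous_visc.mul S.cux)) z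
  have cP : ∀ z, Continuous fun t => S.pressure z t :=
    continuous_slice_right S.continuous_pressure
  have himp : ∀ z, S.impulse z τ
      = ∫ t in (0 : ℝ)..τ, (visc α (S.v z t) * S.ux z t / S.v z t - S.pressure z t) := by
    intro z
    rw [intervalIntegral.integral_sub ((cσ z).intervalIntegrable _ _)
      ((cP z).intervalIntegrable _ _)]
    unfold impulse
    congr 1
    refine (intervalIntegral.integral_eq_sub_of_hasDeriv_right_of_le hτ.1
      (f := fun t => viscPrim α (S.v z t))
      (continuous_slice_right (f := fun x t => viscPrim α (S.v x t))
        S.continuous_viscPrim z).continuousOn (fun t ht => ?_)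
      ((cσ z).intervalIntegrable _ _)).symm
    have ht' : t ∈ Ioo 0 T := ⟨ht.1, ht.2.trans_le hτ.2⟩
    have h1 := (viscPrim_hasDerivAt α (S.v_pos z t)).comp t
      ((S.v_dt z t (Ioo_subset_Icc_self ht')).hasDerivAt (Icc_mem_nhds ht'.1 ht'.2))
    exact (h1.congr_deriv (by ring)).hasDerivWithinAt
  have hbal := integral_sub_eq_of_balance (a := a) (b := x) hτ (E := S.u) (Et := S.ut)
    (J := fun x t => visc α (S.v x t) * S.ux x t / S.v x t - S.pressure x t)
    (S := fun _ _ => 0) S.u_dt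
    (fun x t ht => (S.stress_dx x t ht).congr_deriv (by ring)) S.cu S.cut continuous_const
  have cσP : ∀ z, Continuous fun t => visc α (S.v z t) * S.ux z t / S.v z t - S.pressure z t :=
    fun z => (cσ z).sub (cP z)
  rw [hbal, himp, himp, ← intervalIntegral.integral_sub
    ((cσP x).intervalIntegrable _ _) ((cσP a).intervalIntegrable _ _)]
  simp

variable {S}

lemma Controlled.abs_impulse_sub_le (h : S.Controlled δ V₀ C) (hα : 0 ≤ α) {a x τ : ℝ}
    (hx : x ∈ Icc a (a + 1)) (hτ : τ ∈ Icc 0 T) :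
    |S.impulse x τ - S.impulse a τ| ≤ 2 * C + 2 := by
  have hu : ∀ s ∈ Icc 0 T, |∫ y in a..x, S.u y s| ≤ C + 1 := by
    intro s hs
    have cu := continuous_slice_left S.cu s
    calc |∫ y in a..x, S.u y s| ≤ ∫ y in a..x, |S.u y s| :=
          intervalIntegral.abs_integral_le_integral_abs hx.1
      _ ≤ ∫ y in a..a + 1, |S.u y s| :=
          integral_le_of_subinterval cu.abs (fun _ => abs_nonneg _) le_rfl hx.1 hx.2
      _ ≤ 1 * C + 1 := by
          refine h.integral_unit_le hα a hs cu.abs zero_le_one fun y => ?_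
          have := S.u_sq_le_entropy y s
          have h2 := sq_abs (S.u y s)
          nlinarith [sq_nonneg (|S.u y s| - 1)]
      _ = C + 1 := by ring
  have h0 : (0 : ℝ) ∈ Icc 0 T := ⟨le_rfl, hτ.1.trans hτ.2⟩
  rw [S.impulse_sub a x hτ]
  calc _ ≤ |∫ y in a..x, S.u y τ| + |∫ y in a..x, S.u y 0| := abs_sub _ _
    _ ≤ 2 * C + 2 := by linarith [hu τ hτ, hu 0 h0]

end MHDFlow

/-- The specific volume is bounded below in terms of the data. -/
theorem exists_volume_lower_bound {α β T δ V₀ C : ℝ} (hα : 0 ≤ α) (hδ : 0 < δ) (hC : 0 ≤ C) :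
    ∃ c : ℝ, 0 < c ∧ (∃ L₀ : ℝ, ∀ S : MHDFlow α β T, S.Controlled δ V₀ C →
      ∀ x, ∀ τ ∈ Icc 0 T, -L₀ ≤ S.impulse x τ ∧ c ≤ S.v x τ) := by
  set κ := 2 * C + 2 with hκ
  set η := 1 / (2 * C + 2) with hη
  have hη0 : 0 < η := by positivity
  set ch := Real.exp (viscPrim α (Real.exp (-1 - 1 / η))) with hch
  have hch0 : 0 < ch := Real.exp_pos _
  set K₁ := Real.exp (κ - viscPrim α δ) with hK₁
  have hK₁0 : 0 < K₁ := Real.exp_pos _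
  set K₂ := Real.exp (viscPrim α V₀ + κ) * 2 / ch with hK₂
  have hK₂0 : 0 < K₂ := by have := Real.exp_pos (viscPrim α V₀ + κ); positivity
  obtain ⟨CM, hCM0, hCM⟩ := exists_gronwall_bound 1 (K₁ * K₂ * (3 * C + 2)) T (by positivity)
  refine ⟨Real.exp (viscPrim α δ - Real.log (K₂ * CM)), Real.exp_pos _,
    Real.log (K₂ * CM), fun S h a => ?_⟩
  have hV₀ : 0 < V₀ := (S.v_pos a 0).trans_le (h.v₀_le a)
  set Φ : ℝ → ℝ → ℝ := fun y τ => Real.exp (∫ s in (0 : ℝ)..τ, S.pressure y s) with hΦ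
  have cInt : Continuous fun p : ℝ × ℝ => ∫ s in (0 : ℝ)..p.2, S.pressure p.1 s :=
    intervalIntegral.continuous_parametric_intervalIntegral_of_continuous
      (f := fun (p : ℝ × ℝ) s => S.pressure p.1 s)
      (S.continuous_pressure.comp
        (by fun_prop : Continuous fun q : (ℝ × ℝ) × ℝ => (q.1.1, q.2))) continuous_snd
  have cΦ : Continuous fun p : ℝ × ℝ => Φ p.1 p.2 := Real.continuous_exp.comp cInt
  have cPΦ : Continuous fun p : ℝ × ℝ => S.pressure p.1 p.2 * Φ p.1 p.2 :=
    S.continuous_pressure.mul cΦ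
  have hexp : ∀ y τ, Real.exp (viscPrim α (S.v y τ))
      = Real.exp (viscPrim α (S.v y 0)) * Φ y τ * Real.exp (S.impulse y τ) := by
    intro y τ
    rw [hΦ, ← Real.exp_add, ← Real.exp_add]
    congr 1
    unfold MHDFlow.impulse
    ring
  have cexp : ∀ τ, Continuous fun y => Real.exp (viscPrim α (S.v y τ)) := fun τ =>
    Real.continuous_exp.comp
      (continuous_slice_left (f := fun y t => viscPrim α (S.v y t)) S.continuous_viscPrim τ)
  have hup : ∀ y ∈ Icc a (a + 1), ∀ τ ∈ Icc 0 T, Real.exp (viscPrim α (S.v y τ))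
      ≤ Real.exp (viscPrim α V₀ + κ) * Real.exp (S.impulse a τ) * Φ y τ := by
    intro y hy τ hτ
    have h1 := abs_le.1 (h.abs_impulse_sub_le hα hy hτ)
    have h2 := viscPrim_mono hα (S.v_pos y 0) (h.v₀_le y)
    rw [hexp, mul_right_comm]
    refine mul_le_mul_of_nonneg_right ?_ (Real.exp_pos _).le
    rw [← Real.exp_add, ← Real.exp_add]
    exact Real.exp_le_exp.2 (by linarith)
  have hlo : ∀ y ∈ Icc a (a + 1), ∀ τ ∈ Icc 0 T,
      Φ y τ ≤ K₁ * Real.exp (-S.impulse a τ) * S.v y τ := by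
    intro y hy τ hτ
    have h1 := abs_le.1 (h.abs_impulse_sub_le hα hy hτ)
    have h2 := viscPrim_mono hα hδ (h.le_v₀ y)
    calc Φ y τ ≤ K₁ * Real.exp (-S.impulse a τ) * Real.exp (viscPrim α (S.v y τ)) := by
          have h3 : K₁ * Real.exp (-S.impulse a τ) * Real.exp (viscPrim α (S.v y τ))
              = Real.exp (κ - viscPrim α δ + -S.impulse a τ + viscPrim α (S.v y 0)
                + S.impulse y τ) * Φ y τ := by
            rw [hexp, Real.exp_add, Real.exp_add, Real.exp_add]
            ring
          rw [h3]
          refine le_mul_of_one_le_left (Real.exp_pos _).le (Real.one_le_exp ?_)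
          linarith
      _ ≤ _ := by
          gcongr
          exact exp_viscPrim_le (S.v_pos y τ)
  have hM : ∀ τ ∈ Icc 0 T, Real.exp (-S.impulse a τ) ≤ K₂ * ∫ y in a..a + 1, Φ y τ := by
    intro τ hτ
    have cE := continuous_slice_left S.continuous_entropy τ
    have h1 : ch / 2 ≤ ∫ y in a..a + 1, Real.exp (viscPrim α (S.v y τ)) := by
      have h2 : ∫ y in a..a + 1, ch * (1 - η * S.entropy y τ)
          ≤ ∫ y in a..a + 1, Real.exp (viscPrim α (S.v y τ)) := by
        refine intervalIntegral.integral_mono_on (by linarith)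
          (((continuous_const.sub (cE.const_mul η)).const_mul ch).intervalIntegrable _ _)
          ((cexp τ).intervalIntegrable _ _)
          fun y _ => ?_
        refine le_trans ?_ (le_exp_viscPrim hα hη0 (S.v_pos y τ))
        gcongr
        exact S.entropy_v_le_entropy y τ
      rw [intervalIntegral.integral_const_mul, intervalIntegral.integral_sub (by simp)
        ((cE.const_mul η).intervalIntegrable _ _), intervalIntegral.integral_const_mul] at h2
      simp only [intervalIntegral.integral_const, add_sub_cancel_left, smul_eq_mul, one_mul] at h2
      have h3 := h.entropy_unit_le hα a hτ
      have h4 : η * ∫ y in a..a + 1, S.entropy y τ ≤ 1 / 2 := by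
        calc _ ≤ η * C := by gcongr
          _ ≤ 1 / 2 := by
            rw [hη, div_mul_eq_mul_div, div_le_div_iff₀ (by positivity) two_pos]
            linarith
      nlinarith
    have h2 : ∫ y in a..a + 1, Real.exp (viscPrim α (S.v y τ))
        ≤ Real.exp (viscPrim α V₀ + κ) * Real.exp (S.impulse a τ) * ∫ y in a..a + 1, Φ y τ := by
      rw [← intervalIntegral.integral_const_mul]
      exact intervalIntegral.integral_mono_on (by linarith)
        ((cexp τ).intervalIntegrable _ _)
        (((continuous_slice_left cΦ τ).const_mul _).intervalIntegrable _ _)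
        fun y hy => hup y hy τ hτ
    have h3 := h1.trans h2
    rw [Real.exp_neg, hK₂, inv_le_iff_one_le_mul₀ (Real.exp_pos _)]
    rw [div_mul_eq_mul_div, div_mul_eq_mul_div, le_div_iff₀ hch0]
    linarith
  have hgr : ∀ τ ∈ Icc 0 T, ∫ y in a..a + 1, Φ y τ
      ≤ 1 + K₁ * K₂ * (3 * C + 2) * ∫ s in (0 : ℝ)..τ, ∫ y in a..a + 1, Φ y s := by
    intro τ hτ
    have hbal := integral_sub_eq_of_balance (a := a) (b := a + 1) hτ (E := Φ)
      (Et := fun y t => S.pressure y t * Φ y t) (J := fun _ _ => 0)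
      (S := fun y t => -(S.pressure y t * Φ y t))
      (fun y t _ => by
        have cP := continuous_slice_right S.continuous_pressure y
        have hd := intervalIntegral.integral_hasDerivAt_right (cP.intervalIntegrable 0 t)
          cP.stronglyMeasurable.stronglyMeasurableAtFilter cP.continuousAt
        exact (hd.exp.congr_deriv (mul_comm _ _)).hasDerivWithinAt)
      (fun y t _ => (hasDerivAt_const y (0 : ℝ)).congr_deriv (by ring)) cΦ cPΦ cPΦ.neg
    have h0 : ∫ y in a..a + 1, Φ y 0 = 1 := by simp [hΦ]
    rw [h0] at hbal
    simp only [sub_self, zero_sub, intervalIntegral.integral_neg, neg_neg] at hbal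
    have hle : ∫ s in (0 : ℝ)..τ, ∫ y in a..a + 1, S.pressure y s * Φ y s
        ≤ ∫ s in (0 : ℝ)..τ, K₁ * K₂ * (3 * C + 2) * ∫ y in a..a + 1, Φ y s := by
      refine intervalIntegral.integral_mono_on hτ.1
        ((continuous_integral_strip cPΦ _ _).intervalIntegrable _ _)
        (((continuous_integral_strip cΦ _ _).const_mul _).intervalIntegrable _ _) fun s hs => ?_
      have hs' : s ∈ Icc 0 T := ⟨hs.1, hs.2.trans hτ.2⟩
      have cPv : Continuous fun y => S.pressure y s * S.v y s :=
        continuous_slice_left (f := fun y s => S.pressure y s * S.v y s)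
          (S.continuous_pressure.mul S.cv) s
      calc ∫ y in a..a + 1, S.pressure y s * Φ y s
          ≤ ∫ y in a..a + 1, K₁ * Real.exp (-S.impulse a s) * (S.pressure y s * S.v y s) := by
            refine intervalIntegral.integral_mono_on (by linarith)
              ((continuous_slice_left (f := fun y s => S.pressure y s * Φ y s)
                cPΦ s).intervalIntegrable _ _)
              ((cPv.const_mul _).intervalIntegrable _ _) fun y hy => ?_
            have := mul_le_mul_of_nonneg_left (hlo y hy s hs') (S.pressure_nonneg y s)
            linarith
        _ = K₁ * Real.exp (-S.impulse a s) * ∫ y in a..a + 1, S.pressure y s * S.v y s :=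
            intervalIntegral.integral_const_mul _ _
        _ ≤ K₁ * Real.exp (-S.impulse a s) * (3 * C + 2) := by
            gcongr
            exact h.integral_unit_le hα a hs' cPv (by norm_num) fun y => S.pressure_mul_v_le y s
        _ ≤ K₁ * (K₂ * ∫ y in a..a + 1, Φ y s) * (3 * C + 2) := by
            gcongr
            exact hM s hs'
        _ = _ := by ring
    rw [intervalIntegral.integral_const_mul] at hle
    linarith
  intro τ hτ
  have h1 := (hM τ hτ).trans
    (mul_le_mul_of_nonneg_left (hCM _ (continuous_integral_strip cΦ _ _) hgr τ hτ) hK₂0.le)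
  have h2 : -Real.log (K₂ * CM) ≤ S.impulse a τ := by
    have := (Real.le_log_iff_exp_le (by positivity)).2 h1
    linarith
  refine ⟨h2, le_trans (Real.exp_le_exp.2 ?_) (exp_viscPrim_le (α := α) (S.v_pos a τ))⟩
  have h3 : 0 ≤ ∫ s in (0 : ℝ)..τ, S.pressure a s :=
    intervalIntegral.integral_nonneg hτ.1 fun s _ => S.pressure_nonneg a s
  have h4 := viscPrim_mono hα hδ (h.le_v₀ a)
  unfold MHDFlow.impulse at h2
  linarith

/-! ### Integrated maximum of the temperature -/

/-- Cut-off power `((s - 2)₊)² s ^ (-2 - p)`. -/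
def cutPow (p s : ℝ) : ℝ := max (s - 2) 0 ^ 2 * max s 2 ^ (-2 - p)

/-- Derivative of `cutPow p` on the positive half-line. -/
def cutPowDeriv (p s : ℝ) : ℝ :=
  (4 * max (s - 2) 0 - p * max (s - 2) 0 ^ 2) * max s 2 ^ (-3 - p)

/-- Primitive of `cutPow p`. -/
def cutPowPrim (p s : ℝ) : ℝ := ∫ r in (2 : ℝ)..s, cutPow p r

lemma continuous_max_rpow (r : ℝ) : Continuous fun s : ℝ => max s 2 ^ r :=
  (continuous_id.max continuous_const).rpow_const fun s =>
    Or.inl (two_pos.trans_le (le_max_right s 2)).ne'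

lemma continuous_cutPow (p : ℝ) : Continuous (cutPow p) :=
  (((continuous_id.sub continuous_const).max continuous_const).pow 2).mul
    (continuous_max_rpow _)

lemma continuous_cutPowDeriv (p : ℝ) : Continuous (cutPowDeriv p) := by
  have := continuous_max_rpow (-3 - p)
  unfold cutPowDeriv
  fun_prop

lemma cutPow_of_le {p s : ℝ} (hs : s ≤ 2) : cutPow p s = 0 := by
  simp [cutPow, max_eq_right (sub_nonpos.2 hs)]

lemma cutPow_of_ge {p s : ℝ} (hs : 2 ≤ s) : cutPow p s = (s - 2) ^ 2 * s ^ (-2 - p) := by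
  rw [cutPow, max_eq_left (sub_nonneg.2 hs), max_eq_left hs]

lemma cutPowDeriv_of_le {p s : ℝ} (hs : s ≤ 2) : cutPowDeriv p s = 0 := by
  simp [cutPowDeriv, max_eq_right (sub_nonpos.2 hs)]

lemma cutPowDeriv_of_ge {p s : ℝ} (hs : 2 ≤ s) :
    cutPowDeriv p s = (4 * (s - 2) - p * (s - 2) ^ 2) * s ^ (-3 - p) := by
  rw [cutPowDeriv, max_eq_left (sub_nonneg.2 hs), max_eq_left hs]

lemma cutPow_nonneg (p s : ℝ) : 0 ≤ cutPow p s := by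
  unfold cutPow
  positivity

lemma cutPow_hasDerivAt (p s : ℝ) : HasDerivAt (cutPow p) (cutPowDeriv p s) s := by
  rcases lt_trichotomy s 2 with hs | hs | hs
  · rw [cutPowDeriv_of_le hs.le]
    exact (hasDerivAt_const s (0 : ℝ)).congr_of_eventuallyEq
      (mem_of_superset (Iio_mem_nhds hs) fun r hr => cutPow_of_le (le_of_lt hr))
  · subst hs
    have h1 : cutPowDeriv p 2 = 0 := cutPowDeriv_of_le le_rfl
    have h2 : Tendsto (fun r : ℝ => |r - 2| * max r 2 ^ (-2 - p)) (nhds 2) (nhds 0) := by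
      have : Continuous fun r : ℝ => |r - 2| * max r 2 ^ (-2 - p) :=
        (continuous_id.sub continuous_const).abs.mul (continuous_max_rpow _)
      simpa using this.tendsto 2
    rw [h1, hasDerivAt_iff_tendsto]
    refine squeeze_zero (fun r => by positivity) (fun r => ?_) h2
    rw [cutPow_of_le le_rfl]
    simp only [smul_zero, sub_zero, Real.norm_eq_abs, abs_of_nonneg (cutPow_nonneg p r)]
    rcases eq_or_ne r 2 with rfl | hr
    · simp
    · rw [inv_mul_le_iff₀ (abs_pos.2 (sub_ne_zero.2 hr)), ← mul_assoc, abs_mul_abs_self]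
      unfold cutPow
      refine mul_le_mul_of_nonneg_right ?_ (by positivity)
      rcases le_total (r - 2) 0 with h | h
      · rw [max_eq_right h]
        nlinarith
      · rw [max_eq_left h]
        nlinarith
  · have hs0 : 0 < s := two_pos.trans hs
    rw [cutPowDeriv_of_ge hs.le]
    refine HasDerivAt.congr_of_eventuallyEq ?_
      (mem_of_superset (Ioi_mem_nhds hs) fun r hr => cutPow_of_ge (le_of_lt hr))
    refine ((((hasDerivAt_id s).sub_const 2).pow 2).mul
      (Real.hasDerivAt_rpow_const (p := -2 - p) (Or.inl hs0.ne'))).congr_deriv ?_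
    have h3 : s ^ (-2 - p) = s * s ^ (-3 - p) := by
      rw [show -2 - p = 1 + (-3 - p) by ring, Real.rpow_add hs0, Real.rpow_one]
    rw [show -2 - p - 1 = -3 - p by ring, h3]
    simp
    ring

lemma cutPowPrim_hasDerivAt (p s : ℝ) : HasDerivAt (cutPowPrim p) (cutPow p s) s :=
  intervalIntegral.integral_hasDerivAt_right ((continuous_cutPow p).intervalIntegrable _ _)
    (continuous_cutPow p).stronglyMeasurable.stronglyMeasurableAtFilter
    (continuous_cutPow p).continuousAt

lemma cutPow_le_one {p : ℝ} (hp : 0 ≤ p) (s : ℝ) : cutPow p s ≤ 1 := by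
  rcases le_total s 2 with hs | hs
  · rw [cutPow_of_le hs]
    exact zero_le_one
  · have hs0 : 0 < s := two_pos.trans_le hs
    rw [cutPow_of_ge hs]
    have h1 : s ^ (-2 - p) ≤ s ^ (-2 : ℝ) :=
      Real.rpow_le_rpow_of_exponent_le (by linarith) (by linarith)
    have h2 : s ^ (-2 : ℝ) = (s ^ 2)⁻¹ := by
      rw [Real.rpow_neg hs0.le]
      norm_cast
    calc (s - 2) ^ 2 * s ^ (-2 - p) ≤ s ^ 2 * (s ^ 2)⁻¹ := by
          rw [← h2]
          gcongr
          linarith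
      _ = 1 := mul_inv_cancel₀ (by positivity)

lemma cutPowPrim_nonneg (p s : ℝ) : 0 ≤ cutPowPrim p s := by
  rcases le_total 2 s with hs | hs
  · exact intervalIntegral.integral_nonneg hs fun r _ => cutPow_nonneg p r
  · unfold cutPowPrim
    rw [intervalIntegral.integral_zero_ae]
    filter_upwards with r hr
    rw [uIoc_of_ge hs] at hr
    exact cutPow_of_le hr.2

lemma cutPowPrim_le {p : ℝ} (hp : 0 ≤ p) (s : ℝ) : cutPowPrim p s ≤ max (s - 2) 0 := by
  rcases le_total 2 s with hs | hs
  · have := intervalIntegral.integral_mono_on (μ := volume) hs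
      ((continuous_cutPow p).intervalIntegrable _ _)
      (continuous_const.intervalIntegrable (μ := volume) _ _) fun r _ => cutPow_le_one hp r
    simp only [intervalIntegral.integral_const, smul_eq_mul, mul_one] at this
    exact this.trans (le_max_left _ _)
  · unfold cutPowPrim
    rw [intervalIntegral.integral_zero_ae]
    · exact le_max_right _ _
    · filter_upwards with r hr
      rw [uIoc_of_ge hs] at hr
      exact cutPow_of_le hr.2

lemma sq_mul_cutPow_le {p s h : ℝ} (hs : 0 < s) (hh : 2 ≤ s → s ^ (1 - p) ≤ h) :
    s ^ 2 * cutPow p s ≤ h * max (s - 2) 0 := by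
  rcases le_total s 2 with hs2 | hs2
  · rw [cutPow_of_le hs2, max_eq_right (sub_nonpos.2 hs2)]
    simp
  · rw [cutPow_of_ge hs2, max_eq_left (sub_nonneg.2 hs2)]
    have h1 : s ^ 2 * s ^ (-2 - p) * s = s ^ (1 - p) := by
      rw [← Real.rpow_natCast, ← Real.rpow_add hs, ← Real.rpow_add_one hs.ne']
      congr 1
      push_cast
      ring
    have h2 : 0 ≤ s ^ 2 * s ^ (-2 - p) := by positivity
    calc s ^ 2 * ((s - 2) ^ 2 * s ^ (-2 - p))
        = s ^ 2 * s ^ (-2 - p) * (s - 2) * (s - 2) := by ring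
      _ ≤ s ^ 2 * s ^ (-2 - p) * s * (s - 2) := by
          gcongr
          linarith
      _ ≤ h * (s - 2) := by
          rw [h1]
          exact mul_le_mul_of_nonneg_right (hh hs2) (by linarith)

lemma mul_max_rpow_le {p s : ℝ} (hp : 0 ≤ p) (hs : 0 < s) :
    max (s - 2) 0 * max s 2 ^ (-3 - p) ≤ 1 / s ^ 2 := by
  rcases le_total s 2 with hs2 | hs2
  · rw [max_eq_right (sub_nonpos.2 hs2)]
    simp only [zero_mul]
    positivity
  · rw [max_eq_left (sub_nonneg.2 hs2), max_eq_left hs2]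
    have h1 : s ^ (-3 - p) ≤ s ^ (-3 : ℝ) :=
      Real.rpow_le_rpow_of_exponent_le (by linarith) (by linarith)
    have h2 : s ^ (-3 : ℝ) = (s ^ 3)⁻¹ := by
      rw [Real.rpow_neg hs.le]
      norm_cast
    calc (s - 2) * s ^ (-3 - p) ≤ s * (s ^ 3)⁻¹ := by
          rw [← h2]
          gcongr
          linarith
      _ = 1 / s ^ 2 := by
          field_simp

namespace MHDFlow

variable {α β T : ℝ} (S : MHDFlow α β T)

/-- Source density of the temperature functional `cutPowPrim p ∘ θ`. -/
def heatSource (p x t : ℝ) : ℝ :=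
  cutPowDeriv p (S.θ x t) * S.conduction x t
    + cutPow p (S.θ x t) * (S.θ x t / S.v x t * S.ux x t - S.heating x t)

lemma continuous_comp_θ {f : ℝ → ℝ} (hf : Continuous f) :
    Continuous fun p : ℝ × ℝ => f (S.θ p.1 p.2) := hf.comp S.cθ

lemma continuous_heatSource (p : ℝ) : Continuous fun q : ℝ × ℝ => S.heatSource p q.1 q.2 :=
  ((S.continuous_comp_θ (continuous_cutPowDeriv p)).mul S.continuous_conduction).add
    ((S.continuous_comp_θ (continuous_cutPow p)).mul
      (((S.continuous_div_v S.cθ).mul S.cux).sub S.continuous_heating))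

lemma max_θ_sub_two_le (x t : ℝ) : max (S.θ x t - 2) 0 ≤ 2 * S.entropy x t := by
  have h1 := S.θ_le_entropy x t
  have h2 := S.entropy_nonneg x t
  exact max_le (by linarith) (by linarith)

/-- Nonnegative weighted conduction controlled by the temperature functional. -/
def cutConduction (p x t : ℝ) : ℝ :=
  max (S.θ x t - 2) 0 ^ 2 * max (S.θ x t) 2 ^ (-3 - p) * S.conduction x t

lemma continuous_cutConduction (p : ℝ) :
    Continuous fun q : ℝ × ℝ => S.cutConduction p q.1 q.2 := by
  have h1 := S.continuous_comp_θ (continuous_max_rpow (-3 - p))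
  have h2 := S.cθ
  have h3 := S.continuous_conduction
  unfold cutConduction
  fun_prop

lemma heatSource_pointwise (hα : 0 ≤ α) {p c h x t : ℝ} (hp : 0 ≤ p) (hc : 0 < c)
    (hcv : c ≤ S.v x t) (hh : 2 ≤ S.θ x t → S.θ x t ^ (1 - p) ≤ h) (hh0 : 0 ≤ h) :
    1 / 2 * (S.heating x t * cutPow p (S.θ x t)) + p * S.cutConduction p x t
      ≤ -S.heatSource p x t + 4 * S.dissipation x t + h / c * S.entropy x t := by
  have hv := S.v_pos x t
  have hθ := S.θ_pos x t
  have hQ := S.heating_nonneg hα x t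
  have hD := S.conduction_nonneg x t
  have hf := cutPow_nonneg p (S.θ x t)
  have h1 : S.ux x t ^ 2 / S.v x t ≤ S.heating x t := by
    unfold heating
    have := visc_ge_one hα hv
    gcongr
    nlinarith [sq_nonneg (S.ux x t), sq_nonneg (S.w₁x x t), sq_nonneg (S.w₂x x t),
      sq_nonneg (S.b₁x x t), sq_nonneg (S.b₂x x t)]
  have h2 : S.θ x t / S.v x t * S.ux x t
      ≤ 1 / 2 * S.heating x t + S.θ x t ^ 2 / (2 * c) := by
    calc S.θ x t / S.v x t * S.ux x t
        ≤ 1 / 2 * (S.ux x t ^ 2 / S.v x t) + S.θ x t ^ 2 / (2 * S.v x t) := by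
          rw [← sub_nonneg]
          have : 1 / 2 * (S.ux x t ^ 2 / S.v x t) + S.θ x t ^ 2 / (2 * S.v x t)
              - S.θ x t / S.v x t * S.ux x t = (S.ux x t - S.θ x t) ^ 2 / (2 * S.v x t) := by
            field_simp
            ring
          rw [this]
          positivity
      _ ≤ _ := by gcongr
  have h3 := sq_mul_cutPow_le hθ hh
  have h4 := S.max_θ_sub_two_le x t
  have h5 : cutPow p (S.θ x t) * (S.θ x t ^ 2 / (2 * c)) ≤ h / c * S.entropy x t := by
    calc cutPow p (S.θ x t) * (S.θ x t ^ 2 / (2 * c))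
        = (S.θ x t ^ 2 * cutPow p (S.θ x t)) / (2 * c) := by ring
      _ ≤ (h * (2 * S.entropy x t)) / (2 * c) := by
          exact div_le_div_of_nonneg_right (h3.trans (mul_le_mul_of_nonneg_left h4 hh0))
            (by positivity)
      _ = h / c * S.entropy x t := by
          field_simp
  have h6 := mul_le_mul_of_nonneg_left h2 hf
  have h7 := mul_le_mul_of_nonneg_right (mul_max_rpow_le hp hθ) hD
  have h8 : 1 / S.θ x t ^ 2 * S.conduction x t ≤ S.dissipation x t := by
    unfold dissipation
    have : 0 ≤ S.heating x t / S.θ x t := by positivity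
    rw [div_div, ← sq, one_div_mul_eq_div]
    linarith
  unfold heatSource cutConduction cutPowDeriv
  linarith

lemma cutPowPrim_dt (p x t : ℝ) (ht : t ∈ Icc 0 T) :
    HasDerivWithinAt (fun s => cutPowPrim p (S.θ x s)) (cutPow p (S.θ x t) * S.θt x t)
      (Icc 0 T) t :=
  (cutPowPrim_hasDerivAt p (S.θ x t)).comp_hasDerivWithinAt t (S.θ_dt x t ht)

lemma cutPow_flux_dx (p x t : ℝ) (ht : t ∈ Icc 0 T) :
    HasDerivAt (fun y => cutPow p (S.θ y t) * (S.θ y t ^ β * S.θx y t / S.v y t))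
      (cutPow p (S.θ x t) * S.θt x t + S.heatSource p x t) x := by
  refine (((cutPow_hasDerivAt p (S.θ x t)).comp x (S.θ_dx x t)).mul
    (S.heat_dx x t ht)).congr_deriv ?_
  simp only [Function.comp_apply]
  unfold heatSource heating conduction
  ring

variable {S} {δ V₀ C : ℝ}

/-- Weighted estimate for the temperature above the far-field state. -/
lemma Controlled.heat_le (hS : S.Controlled δ V₀ C) (hα : 0 ≤ α) (hT : 0 ≤ T) {p c W : ℝ}
    (hp : 0 ≤ p) (hc : 0 < c) (hcv : ∀ x, ∀ t ∈ Icc 0 T, c ≤ S.v x t) (hW : 0 ≤ W)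
    (hθ : ∀ x t, |x| = W → S.θ x t ≤ 2) {h : ℝ → ℝ} (ch : Continuous h) (h0 : ∀ t, 0 ≤ h t)
    (hh : ∀ x, ∀ t ∈ Icc 0 T, 2 ≤ S.θ x t → S.θ x t ^ (1 - p) ≤ h t) :
    1 / 2 * rectInt (-W) W T (fun x t => S.heating x t * cutPow p (S.θ x t))
      + p * rectInt (-W) W T (S.cutConduction p) ≤ 6 * C + C / c * ∫ t in (0 : ℝ)..T, h t := by
  have hTT : T ∈ Icc 0 T := ⟨hT, le_rfl⟩
  have hWW : -W ≤ W := by linarith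
  have cf := S.continuous_comp_θ (continuous_cutPow p)
  have cΨ : Continuous fun q : ℝ × ℝ => cutPowPrim p (S.θ q.1 q.2) :=
    S.continuous_comp_θ
      (continuous_iff_continuousAt.2 fun s => (cutPowPrim_hasDerivAt p s).continuousAt)
  have cs := S.continuous_heatSource p
  have hbal := integral_sub_eq_of_balance (a := -W) (b := W) hTT
    (E := fun x t => cutPowPrim p (S.θ x t)) (Et := fun x t => cutPow p (S.θ x t) * S.θt x t)
    (J := fun x t => cutPow p (S.θ x t) * (S.θ x t ^ β * S.θx x t / S.v x t))
    (S := S.heatSource p) (S.cutPowPrim_dt p) (S.cutPow_flux_dx p) cΨ (cf.mul S.cθt) cs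
  simp only [cutPow_of_le (hθ W _ (abs_of_nonneg hW)),
    cutPow_of_le (hθ (-W) _ (by rw [abs_neg, abs_of_nonneg hW])), zero_mul, sub_self,
    zero_sub, intervalIntegral.integral_neg] at hbal
  have hsrc : -rectInt (-W) W T (S.heatSource p) ≤ 2 * C := by
    have h1 : ∫ x in -W..W, cutPowPrim p (S.θ x T) ≤ ∫ x in -W..W, 2 * S.entropy x T :=
      intervalIntegral.integral_mono_on hWW
        ((continuous_slice_left (f := fun x t => cutPowPrim p (S.θ x t)) cΨ
          T).intervalIntegrable _ _)
        (((continuous_slice_left S.continuous_entropy T).const_mul 2).intervalIntegrable _ _)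
        fun x _ => (cutPowPrim_le hp _).trans (S.max_θ_sub_two_le x T)
    have h2 : 0 ≤ ∫ x in -W..W, cutPowPrim p (S.θ x 0) :=
      intervalIntegral.integral_nonneg hWW fun x _ => cutPowPrim_nonneg p _
    rw [intervalIntegral.integral_const_mul] at h1
    have h3 := hS.entropy_le hα hW hTT
    unfold rectInt
    linarith
  have cE : Continuous fun q : ℝ × ℝ => h q.2 / c * S.entropy q.1 q.2 :=
    ((ch.comp continuous_snd).div_const c).mul S.continuous_entropy
  have c1 : Continuous fun q : ℝ × ℝ => 1 / 2 * (S.heating q.1 q.2 * cutPow p (S.θ q.1 q.2)) :=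
    (S.continuous_heating.mul cf).const_mul _
  have c2 : Continuous fun q : ℝ × ℝ => p * S.cutConduction p q.1 q.2 :=
    (S.continuous_cutConduction p).const_mul _
  have c3 : Continuous fun q : ℝ × ℝ => -1 * S.heatSource p q.1 q.2 := cs.const_mul _
  have c4 : Continuous fun q : ℝ × ℝ => 4 * S.dissipation q.1 q.2 :=
    S.continuous_dissipation.const_mul _
  have hmain := rectInt_mono hWW hT
    (f := fun x t => 1 / 2 * (S.heating x t * cutPow p (S.θ x t)) + p * S.cutConduction p x t)
    (g := fun x t => -1 * S.heatSource p x t + 4 * S.dissipation x t + h t / c * S.entropy x t)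
    (c1.add c2) ((c3.add c4).add cE) fun x _ t ht => by
      have := S.heatSource_pointwise hα hp hc (hcv x t ht) (hh x t ht) (h0 t)
      linarith
  rw [rectInt_add (f := fun x t => 1 / 2 * (S.heating x t * cutPow p (S.θ x t))) c1 c2,
    rectInt_add (f := fun x t => -1 * S.heatSource p x t + 4 * S.dissipation x t)
      (c3.add c4) cE,
    rectInt_add (f := fun x t => -1 * S.heatSource p x t) c3 c4, rectInt_const_mul,
    rectInt_const_mul, rectInt_const_mul, rectInt_const_mul] at hmain
  have hdis := hS.dissipation_le hW hTT
  have hent : rectInt (-W) W T (fun x t => h t / c * S.entropy x t)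
      ≤ C / c * ∫ t in (0 : ℝ)..T, h t := by
    rw [← intervalIntegral.integral_const_mul]
    refine intervalIntegral.integral_mono_on hT
      ((continuous_integral_strip (f := fun x t => h t / c * S.entropy x t)
        cE _ _).intervalIntegrable _ _)
      ((ch.const_mul _).intervalIntegrable _ _) fun t ht => ?_
    rw [intervalIntegral.integral_const_mul]
    have := hS.entropy_le hα hW ht
    calc h t / c * ∫ x in -W..W, S.entropy x t ≤ h t / c * C := by
          have := h0 t
          gcongr
      _ = C / c * h t := by ring
  linarith

end MHDFlow

lemma cutPow_neg_half_le {s : ℝ} (hs : 0 < s) : cutPow (-1 / 2) s ≤ s := by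
  rcases le_total s 2 with h | h
  · rw [cutPow_of_le h]
    exact hs.le
  · rw [cutPow_of_ge h]
    have h1 : s ^ (-2 - -1 / 2 : ℝ) ≤ s ^ (-1 : ℝ) :=
      Real.rpow_le_rpow_of_exponent_le (by linarith) (by norm_num)
    rw [Real.rpow_neg_one] at h1
    calc (s - 2) ^ 2 * s ^ (-2 - -1 / 2 : ℝ) ≤ s ^ 2 * s⁻¹ := by
          gcongr
          linarith
      _ = s := by field_simp

lemma le_cutPow_neg_half_sq {s : ℝ} : s ≤ 4 + 16 * cutPow (-1 / 2) s ^ 2 := by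
  rcases le_total s 4 with h | h
  · have := sq_nonneg (cutPow (-1 / 2) s)
    linarith
  · have hs : 0 < s := by linarith
    rw [cutPow_of_ge (by linarith), mul_pow]
    have h1 : (s ^ (-2 - -1 / 2 : ℝ)) ^ 2 = (s ^ 3)⁻¹ := by
      rw [← Real.rpow_natCast, ← Real.rpow_mul hs.le, ← Real.rpow_natCast s 3,
        ← Real.rpow_neg hs.le]
      norm_num
    have h2 : s / 2 ≤ s - 2 := by linarith
    have h3 : (s / 2) ^ 4 ≤ ((s - 2) ^ 2) ^ 2 := by
      rw [← pow_mul]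
      gcongr
    rw [h1]
    calc s = 16 * ((s / 2) ^ 4 * (s ^ 3)⁻¹) := by
          field_simp
          norm_num
      _ ≤ 16 * (((s - 2) ^ 2) ^ 2 * (s ^ 3)⁻¹) := by gcongr
      _ ≤ _ := by linarith

lemma abs_cutPowDeriv_neg_half_le (s : ℝ) :
    |cutPowDeriv (-1 / 2) s| ≤ 5 / 2 * (max (s - 2) 0 * max s 2 ^ (-3 / 2 : ℝ)) := by
  rcases le_total s 2 with h | h
  · rw [cutPowDeriv_of_le h, max_eq_right (sub_nonpos.2 h)]
    simp
  · have hs : 0 < s := by linarith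
    have hm : 0 ≤ s - 2 := by linarith
    have h1 : s ^ (-3 - -1 / 2 : ℝ) = s ^ (-3 / 2 : ℝ) / s := by
      rw [← Real.rpow_sub_one hs.ne']
      norm_num
    have h2 : 0 ≤ s ^ (-3 / 2 : ℝ) := by positivity
    rw [cutPowDeriv_of_ge h, max_eq_left hm, max_eq_left h, h1, abs_of_nonneg]
    · calc (4 * (s - 2) - -1 / 2 * (s - 2) ^ 2) * (s ^ (-3 / 2 : ℝ) / s)
          = (4 * (s - 2) + 1 / 2 * (s - 2) ^ 2) / s * s ^ (-3 / 2 : ℝ) := by ring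
        _ ≤ (5 / 2 * (s - 2)) * s ^ (-3 / 2 : ℝ) := by
          gcongr
          rw [div_le_iff₀ hs]
          nlinarith
        _ = _ := by ring
    · have : 0 ≤ 4 * (s - 2) - -1 / 2 * (s - 2) ^ 2 := by nlinarith [sq_nonneg (s - 2)]
      positivity

namespace MHDFlow

variable {α β T : ℝ} (S : MHDFlow α β T)

/-- Weighted temperature gradient controlling the maximum of the temperature. -/
def slope (x t : ℝ) : ℝ :=
  (max (S.θ x t - 2) 0 * max (S.θ x t) 2 ^ (-3 / 2 : ℝ) * S.θx x t) ^ 2 / S.v x t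

lemma continuous_slope : Continuous fun p : ℝ × ℝ => S.slope p.1 p.2 := by
  refine S.continuous_div_v ?_
  have h1 := S.continuous_comp_θ (continuous_max_rpow (-3 / 2))
  have h2 := S.cθ
  have h3 := S.cθx
  fun_prop

lemma slope_nonneg (x t : ℝ) : 0 ≤ S.slope x t := by
  have := S.v_pos x t
  unfold slope
  positivity

lemma slope_le_cutConduction {p : ℝ} (hp : p ≤ β) (x t : ℝ) :
    S.slope x t ≤ S.cutConduction p x t := by
  have hv := S.v_pos x t
  have hθ := S.θ_pos x t
  unfold slope cutConduction conduction
  rcases le_total (S.θ x t) 2 with h | h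
  · rw [max_eq_right (sub_nonpos.2 h)]
    simp
  · rw [max_eq_left (sub_nonneg.2 h), max_eq_left h]
    have h1 : (S.θ x t ^ (-3 / 2 : ℝ)) ^ 2 ≤ S.θ x t ^ (-3 - p) * S.θ x t ^ β := by
      rw [← Real.rpow_natCast, ← Real.rpow_mul hθ.le, ← Real.rpow_add hθ]
      refine Real.rpow_le_rpow_of_exponent_le (by linarith) ?_
      norm_num
      linarith
    calc _ = (S.θ x t ^ (-3 / 2 : ℝ)) ^ 2 * ((S.θ x t - 2) ^ 2 * (S.θx x t ^ 2 / S.v x t)) := by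
          ring
      _ ≤ S.θ x t ^ (-3 - p) * S.θ x t ^ β
          * ((S.θ x t - 2) ^ 2 * (S.θx x t ^ 2 / S.v x t)) := by gcongr
      _ = _ := by ring

variable {S} {δ V₀ C : ℝ}

/-- Pointwise bound of the temperature by the local weighted gradient. -/
lemma Controlled.θ_le_slope (hS : S.Controlled δ V₀ C) (hα : 0 ≤ α) (hC : 0 ≤ C) {x t : ℝ}
    (ht : t ∈ Icc 0 T) :
    S.θ x t ≤ (4 + 16 * (5 * C + 6) ^ 2) * (1 + ∫ y in x..x + 1, S.slope y t) := by
  set A := ∫ y in x..x + 1, S.slope y t with hA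
  have hA0 : 0 ≤ A := intervalIntegral.integral_nonneg (by linarith) fun y _ => S.slope_nonneg y t
  set q := √(1 + A) with hq
  have hq2 : q ^ 2 = 1 + A := Real.sq_sqrt (by linarith)
  have hq1 : 1 ≤ q := Real.one_le_sqrt.2 (by linarith)
  have cs := continuous_slice_left S.continuous_slope t
  have cv := continuous_slice_left S.cv t
  have cθ := continuous_slice_left S.cθ t
  have hd : ∀ y, HasDerivAt (fun y => cutPow (-1 / 2) (S.θ y t))
      (cutPowDeriv (-1 / 2) (S.θ y t) * S.θx y t) y := fun y =>
    HasDerivAt.comp (h₂ := cutPow (-1 / 2)) y (cutPow_hasDerivAt (-1 / 2) (S.θ y t)) (S.θ_dx y t)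
  have cg : Continuous fun y => 5 / 4 * (1 / q * S.slope y t + q * S.v y t) :=
    ((cs.const_mul _).add (cv.const_mul _)).const_mul _
  have hbd := le_integral_add_integral_of_abs_deriv_le hd cg
    (((continuous_cutPowDeriv _).comp cθ).mul (continuous_slice_left S.cθx t))
    (fun y => ?_) (⟨le_rfl, by linarith⟩ : x ∈ Icc x (x + 1))
  · have h1 := hS.integral_unit_le hα x ht ((continuous_cutPow (-1 / 2)).comp cθ)
      (A := 2) (B := 2) two_pos.le
      fun y => (cutPow_neg_half_le (S.θ_pos y t)).trans (S.θ_le_entropy y t)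
    have h2 := hS.integral_unit_le hα x ht cv two_pos.le fun y => S.v_le_entropy y t
    rw [intervalIntegral.integral_const_mul, intervalIntegral.integral_add
      ((cs.const_mul _).intervalIntegrable _ _) ((cv.const_mul _).intervalIntegrable _ _),
      intervalIntegral.integral_const_mul, intervalIntegral.integral_const_mul, ← hA] at hbd
    simp only [Function.comp_apply] at h1
    have h3 : 1 / q * A ≤ q := by
      rw [one_div_mul_eq_div, div_le_iff₀ (by linarith)]
      linarith
    have h4 : q * ∫ y in x..x + 1, S.v y t ≤ q * (2 * C + 2) :=
      mul_le_mul_of_nonneg_left h2 (by linarith)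
    have h5 : cutPow (-1 / 2) (S.θ x t) ≤ (5 * C + 6) * q := by nlinarith
    have h6 : cutPow (-1 / 2) (S.θ x t) ^ 2 ≤ ((5 * C + 6) * q) ^ 2 :=
      pow_le_pow_left₀ (cutPow_nonneg _ _) h5 2
    have h7 := le_cutPow_neg_half_sq (s := S.θ x t)
    rw [mul_pow, hq2] at h6
    nlinarith
  · have hv := S.v_pos y t
    have h1 := mul_le_mul_of_nonneg_right (abs_cutPowDeriv_neg_half_le (S.θ y t))
      (abs_nonneg (S.θx y t))
    set a := max (S.θ y t - 2) 0 * max (S.θ y t) 2 ^ (-3 / 2 : ℝ) with ha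
    have h2 : 1 / q * S.slope y t + q * S.v y t - 2 * (a * |S.θx y t|)
        = (a * |S.θx y t| - q * S.v y t) ^ 2 / (q * S.v y t) := by
      have : S.slope y t = (a * |S.θx y t|) ^ 2 / S.v y t := by
        rw [mul_pow, sq_abs, ← mul_pow]
        rfl
      rw [this]
      field_simp
      ring
    have h3 : 0 ≤ (a * |S.θx y t| - q * S.v y t) ^ 2 / (q * S.v y t) := by positivity
    rw [abs_mul]
    linarith

end MHDFlow

lemma rpow_one_sub_le {p ε s : ℝ} (hp : 0 < p) (hε : 0 < ε) (hs : 1 ≤ s) :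
    s ^ (1 - p) ≤ ε * s + ε ^ (-1 / p) := by
  have hs0 : 0 < s := by linarith
  rcases le_total s (ε ^ (-1 / p)) with h | h
  · have h1 : s ^ (1 - p) ≤ s ^ (1 : ℝ) :=
      Real.rpow_le_rpow_of_exponent_le hs (by linarith)
    rw [Real.rpow_one] at h1
    have := mul_pos hε hs0
    linarith
  · have h1 : s ^ (-p) ≤ (ε ^ (-1 / p)) ^ (-p) :=
      Real.rpow_le_rpow_of_nonpos (by positivity) h (by linarith)
    rw [← Real.rpow_mul hε.le, show -1 / p * -p = 1 by field_simp, Real.rpow_one] at h1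
    have h2 : s ^ (1 - p) = s ^ (-p) * s := by
      rw [← Real.rpow_add_one hs0.ne']
      congr 1
      ring
    have h3 : 0 < ε ^ (-1 / p) := by positivity
    have := mul_le_mul_of_nonneg_right h1 hs0.le
    linarith

namespace MHDFlow

lemma exists_θ_le_two {α β T : ℝ} (S : MHDFlow α β T) :
    ∃ R : ℝ, 0 ≤ R ∧ ∀ x t, R ≤ |x| → S.θ x t ≤ 2 := by
  have h1 := S.θ_far.eventually_le_const one_lt_two
  rw [eventually_comap] at h1
  obtain ⟨M, hM⟩ := eventually_atTop.1 h1
  exact ⟨max M 0, le_max_right _ _, fun x t hx =>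
    hM |x| ((le_max_left _ _).trans hx) (x, t) rfl⟩

end MHDFlow

/-- The maximum of the temperature is integrable in time, with a bound in terms of the data. -/
theorem exists_temperature_bound {α β T δ V₀ C c : ℝ} (hα : 0 ≤ α) (hβ : 0 < β) (hT : 0 < T)
    (hC : 0 ≤ C) (hc : 0 < c) :
    ∃ M : ℝ, 0 ≤ M ∧ ∀ S : MHDFlow α β T, S.Controlled δ V₀ C →
      (∀ x, ∀ t ∈ Icc 0 T, c ≤ S.v x t) →
      ∃ G : ℝ → ℝ, Continuous G ∧ (∀ t, 0 ≤ G t) ∧ (∀ x, ∀ t ∈ Icc 0 T, S.θ x t ≤ G t) ∧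
        ∫ t in (0 : ℝ)..T, G t ≤ M := by
  set B := 4 + 16 * (5 * C + 6) ^ 2 with hB
  have hB0 : 0 < B := by positivity
  set ε := β * c / (2 * (C + 1) * B) with hε
  have hε0 : 0 < ε := by positivity
  set s₀ := ε ^ (-1 / β) with hs₀
  have hs₀0 : 0 < s₀ := by positivity
  have hCε : C / c * (ε * B) ≤ β / 2 := by
    rw [hε, show C / c * (β * c / (2 * (C + 1) * B) * B) = β / 2 * (C / (C + 1)) by field_simp]
    have : C / (C + 1) ≤ 1 := (div_le_one (by linarith)).2 (by linarith)
    nlinarith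
  set M₁ := 2 / β * (6 * C + β / 2 * T + C / c * (s₀ * T)) with hM₁
  refine ⟨B * (T + M₁), by positivity, fun S hS hcv => ?_⟩
  obtain ⟨R, hR0, hR⟩ := S.exists_θ_le_two
  set A : ℝ → ℝ := fun t => ∫ x in -(R + 1)..R + 1, S.slope x t with hA
  have cA : Continuous A := continuous_integral_strip S.continuous_slope _ _
  have hA0 : ∀ t, 0 ≤ A t := fun t =>
    intervalIntegral.integral_nonneg (by linarith) fun x _ => S.slope_nonneg x t
  have hθ : ∀ x, ∀ t ∈ Icc 0 T, S.θ x t ≤ B * (1 + A t) := by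
    intro x t ht
    rcases le_total R |x| with hx | hx
    · refine (hR x t hx).trans ?_
      nlinarith [hA0 t, mul_nonneg hB0.le (hA0 t), sq_nonneg (5 * C + 6)]
    · obtain ⟨hx1, hx2⟩ := abs_le.1 hx
      refine (hS.θ_le_slope hα hC ht).trans ?_
      have := integral_le_of_subinterval (continuous_slice_left S.continuous_slope t)
        (fun x => S.slope_nonneg x t) (by linarith : -(R + 1) ≤ x)
        (by linarith : x ≤ x + 1) (by linarith : x + 1 ≤ R + 1)
      gcongr
  have cG : Continuous fun t => B * (1 + A t) := (continuous_const.add cA).const_mul B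
  have hmain := hS.heat_le hα hT.le hβ.le hc hcv (by linarith : 0 ≤ R + 1)
    (fun x t hx => hR x t (by linarith)) (h := fun t => ε * (B * (1 + A t)) + s₀)
    ((cG.const_mul ε).add continuous_const)
    (fun t => by have := hA0 t; positivity) fun x t ht h2 =>
      (rpow_one_sub_le hβ hε0 (by linarith)).trans (by
        have := hθ x t ht
        gcongr)
  have hAle : ∫ t in (0 : ℝ)..T, A t ≤ rectInt (-(R + 1)) (R + 1) T (S.cutConduction β) :=
    rectInt_mono (by linarith) hT.le S.continuous_slope (S.continuous_cutConduction β)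
      fun x _ t _ => S.slope_le_cutConduction le_rfl x t
  have hQ : 0 ≤ rectInt (-(R + 1)) (R + 1) T
      (fun x t => S.heating x t * cutPow β (S.θ x t)) :=
    rectInt_nonneg (by linarith) hT.le fun x _ t _ =>
      mul_nonneg (S.heating_nonneg hα x t) (cutPow_nonneg _ _)
  have hint : ∫ t in (0 : ℝ)..T, B * (1 + A t) = B * (T + ∫ t in (0 : ℝ)..T, A t) := by
    rw [intervalIntegral.integral_const_mul, intervalIntegral.integral_add (by simp)
      (cA.intervalIntegrable _ _)]
    simp
  have hint2 : ∫ t in (0 : ℝ)..T, (ε * (B * (1 + A t)) + s₀)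
      = ε * (B * (T + ∫ t in (0 : ℝ)..T, A t)) + s₀ * T := by
    rw [intervalIntegral.integral_add ((cG.const_mul ε).intervalIntegrable _ _) (by simp),
      intervalIntegral.integral_const_mul, hint]
    simp [mul_comm]
  rw [hint2] at hmain
  set a := ∫ t in (0 : ℝ)..T, A t with ha
  have ha0 : 0 ≤ a := intervalIntegral.integral_nonneg hT.le fun t _ => hA0 t
  have hM₁a : a ≤ M₁ := by
    have h1 : C / c * (ε * B) * (T + a) ≤ β / 2 * (T + a) :=
      mul_le_mul_of_nonneg_right hCε (by linarith)
    have h2 : β * a ≤ β * rectInt (-(R + 1)) (R + 1) T (S.cutConduction β) := by gcongr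
    rw [hM₁, div_mul_eq_mul_div, le_div_iff₀ hβ]
    linarith
  refine ⟨fun t => B * (1 + A t), cG, fun t => ?_, hθ, ?_⟩
  · have := hA0 t
    positivity
  · rw [hint]
    gcongr

/-! ### Upper bound for the specific volume and the gradient estimate -/

lemma viscPrim_le {α z : ℝ} (hz : 0 < z) : viscPrim α z ≤ z := by
  have h1 := Real.log_le_sub_one_of_pos hz
  have h2 := Real.rpow_pos_of_pos hz (-α)
  unfold viscPrim
  linarith

namespace MHDFlow.Controlled

variable {α β T : ℝ} {S : MHDFlow α β T} {δ V₀ C : ℝ}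

lemma impulse_le (h : S.Controlled δ V₀ C) (hα : 0 ≤ α) (hδ : 0 < δ) (x : ℝ) {τ : ℝ}
    (hτ : τ ∈ Icc 0 T) : S.impulse x τ ≤ 4 * C + 4 - viscPrim α δ := by
  have cv := continuous_slice_left S.cv τ
  have key : ∀ y ∈ Icc x (x + 1), S.impulse x τ - (2 * C + 2) + viscPrim α δ ≤ S.v y τ := by
    intro y hy
    have h1 := abs_le.1 (h.abs_impulse_sub_le hα hy hτ)
    have h2 : 0 ≤ ∫ s in (0 : ℝ)..τ, S.pressure y s :=
      intervalIntegral.integral_nonneg hτ.1 fun s _ => S.pressure_nonneg y s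
    have h3 := viscPrim_mono hα hδ (h.le_v₀ y)
    have h4 := viscPrim_le (α := α) (S.v_pos y τ)
    have h5 : S.impulse y τ
        = viscPrim α (S.v y τ) - viscPrim α (S.v y 0) - ∫ s in (0 : ℝ)..τ, S.pressure y s := rfl
    linarith
  have h1 := intervalIntegral.integral_mono_on (μ := volume) (by linarith : x ≤ x + 1)
    (continuous_const.intervalIntegrable _ _) (cv.intervalIntegrable _ _) key
  have h2 := h.integral_unit_le hα x hτ cv two_pos.le fun y => S.v_le_entropy y τ
  simp only [intervalIntegral.integral_const, add_sub_cancel_left, smul_eq_mul, one_mul] at h1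
  linarith

lemma b_sq_le (h : S.Controlled δ V₀ C) (hα : 0 ≤ α) {c g x t : ℝ} (hc : 0 < c)
    (hcv : ∀ y, c ≤ S.v y t) (hg0 : 0 ≤ g) (hg : ∀ y, S.θ y t ≤ g) (ht : t ∈ Icc 0 T) :
    S.b₁ x t ^ 2 + S.b₂ x t ^ 2
      ≤ 2 * C / c + 2 * C * g + ∫ y in x..x + 1, S.dissipation y t := by
  have cv := continuous_slice_left S.cv t
  have cθ := continuous_slice_left S.cθ t
  have cb₁ := continuous_slice_left S.cb₁ t
  have cb₂ := continuous_slice_left S.cb₂ t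
  have cb₁x := continuous_slice_left S.cb₁x t
  have cb₂x := continuous_slice_left S.cb₂x t
  have cD := continuous_slice_left S.continuous_dissipation t
  have cV : Continuous fun y => S.θ y t * (S.v y t * (S.b₁ y t ^ 2 + S.b₂ y t ^ 2)) := by
    fun_prop
  have hd : ∀ y, HasDerivAt (fun y => S.b₁ y t ^ 2 + S.b₂ y t ^ 2)
      (2 * (S.b₁ y t * S.b₁x y t + S.b₂ y t * S.b₂x y t)) y := fun y =>
    (((S.b₁_dx y t).pow 2).add ((S.b₂_dx y t).pow 2)).congr_deriv (by simp; ring)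
  have hbd := le_integral_add_integral_of_abs_deriv_le hd
    (g := fun y => S.dissipation y t + S.θ y t * (S.v y t * (S.b₁ y t ^ 2 + S.b₂ y t ^ 2)))
    (cD.add cV) (by fun_prop) (fun y => ?_) (⟨le_rfl, by linarith⟩ : x ∈ Icc x (x + 1))
  · rw [intervalIntegral.integral_add (cD.intervalIntegrable _ _)
      (cV.intervalIntegrable _ _)] at hbd
    have h1 := h.integral_unit_le hα x ht (f := fun y => S.b₁ y t ^ 2 + S.b₂ y t ^ 2)
      (A := 2 / c) (B := 0) (by fun_prop) (by positivity) fun y => by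
        have h2 := S.vb_le_entropy y t
        have h3 := mul_le_mul_of_nonneg_right (hcv y)
          (by positivity : 0 ≤ S.b₁ y t ^ 2 + S.b₂ y t ^ 2)
        rw [add_zero, div_mul_eq_mul_div, le_div_iff₀ hc]
        linarith
    have h2 := h.integral_unit_le hα x ht cV (A := 2 * g) (B := 0) (by positivity) fun y => by
      have h2 := S.vb_le_entropy y t
      have h3 : 0 ≤ S.v y t * (S.b₁ y t ^ 2 + S.b₂ y t ^ 2) := by
        have := S.v_pos y t
        positivity
      calc _ ≤ g * (S.v y t * (S.b₁ y t ^ 2 + S.b₂ y t ^ 2)) :=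
            mul_le_mul_of_nonneg_right (hg y) h3
        _ ≤ g * (2 * S.entropy y t) := mul_le_mul_of_nonneg_left (by linarith) hg0
        _ = _ := by ring
    have h3 : 2 / c * C = 2 * C / c := by ring
    linarith
  · have hv := S.v_pos y t
    have hθ := S.θ_pos y t
    have h1 : (S.b₁x y t ^ 2 + S.b₂x y t ^ 2) / S.v y t / S.θ y t ≤ S.dissipation y t := by
      have h2 := S.conduction_nonneg y t
      have h3 : 0 ≤ S.conduction y t / S.θ y t / S.θ y t := by positivity
      have h4 : (S.b₁x y t ^ 2 + S.b₂x y t ^ 2) / S.v y t / S.θ y t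
          ≤ S.heating y t / S.θ y t := by
        unfold MHDFlow.heating
        have := visc_ge_one hα hv
        have h5 : 0 ≤ visc α (S.v y t) * S.ux y t ^ 2 + (S.w₁x y t ^ 2 + S.w₂x y t ^ 2) := by
          positivity
        exact div_le_div_of_nonneg_right (div_le_div_of_nonneg_right (by linarith) hv.le) hθ.le
      unfold MHDFlow.dissipation
      linarith
    have h2 : ∀ a r : ℝ, 2 * |a * r| ≤ r ^ 2 / S.v y t / S.θ y t
        + S.θ y t * (S.v y t * a ^ 2) := by
      intro a r
      rw [div_div, abs_mul]
      have h3 : r ^ 2 / (S.v y t * S.θ y t) + S.θ y t * (S.v y t * a ^ 2) - 2 * (|a| * |r|)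
          = (|r| - S.v y t * S.θ y t * |a|) ^ 2 / (S.v y t * S.θ y t) := by
        rw [← sq_abs r, ← sq_abs a]
        field_simp
        ring
      have h4 : 0 ≤ (|r| - S.v y t * S.θ y t * |a|) ^ 2 / (S.v y t * S.θ y t) := by positivity
      linarith
    have h3 := h2 (S.b₁ y t) (S.b₁x y t)
    have h4 := h2 (S.b₂ y t) (S.b₂x y t)
    rw [abs_mul, abs_two]
    have h5 := abs_add_le (S.b₁ y t * S.b₁x y t) (S.b₂ y t * S.b₂x y t)
    rw [add_div, add_div] at h1
    linarith

lemma v_le (h : S.Controlled δ V₀ C) (hα : 0 ≤ α) (hδ : 0 < δ) {c M : ℝ}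
    (hC : 0 ≤ C) (hc : 0 < c) (hcv : ∀ x, ∀ t ∈ Icc 0 T, c ≤ S.v x t) {G : ℝ → ℝ}
    (cG : Continuous G) (hG0 : ∀ t, 0 ≤ G t) (hG : ∀ x, ∀ t ∈ Icc 0 T, S.θ x t ≤ G t)
    (hGM : ∫ t in (0 : ℝ)..T, G t ≤ M) (x : ℝ) {τ : ℝ} (hτ : τ ∈ Icc 0 T) :
    S.v x τ ≤ Real.exp (V₀ + (4 * C + 4 - viscPrim α δ) + (M / c + C / c * T + C * M + C)
      + c ^ (-α)) := by
  have hGτ : ∫ t in (0 : ℝ)..τ, G t ≤ M :=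
    (integral_le_of_subinterval cG hG0 le_rfl hτ.1 hτ.2).trans hGM
  have cD := continuous_integral_strip S.continuous_dissipation x (x + 1)
  have hP : ∫ t in (0 : ℝ)..τ, S.pressure x t ≤ M / c + C / c * T + C * M + C := by
    have h1 : ∫ t in (0 : ℝ)..τ, S.pressure x t ≤ ∫ t in (0 : ℝ)..τ,
        ((1 / c + C) * G t + (C / c + 1 / 2 * ∫ y in x..x + 1, S.dissipation y t)) := by
      refine intervalIntegral.integral_mono_on hτ.1
        ((continuous_slice_right S.continuous_pressure x).intervalIntegrable _ _)
        (((cG.const_mul _).add (continuous_const.add (cD.const_mul _))).intervalIntegrable _ _)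
        fun t ht => ?_
      have ht' : t ∈ Icc 0 T := ⟨ht.1, ht.2.trans hτ.2⟩
      have h2 := h.b_sq_le hα (x := x) hc (fun y => hcv y t ht') (hG0 t)
        (fun y => hG y t ht') ht'
      have h3 : S.θ x t / S.v x t ≤ G t / c :=
        div_le_div₀ (hG0 t) (hG x t ht') hc (hcv x t ht')
      have h4 : 2 * C / c = 2 * (C / c) := by ring
      have h5 : (1 / c + C) * G t = G t / c + C * G t := by ring
      unfold MHDFlow.pressure
      linarith
    have cR : Continuous fun t => C / c + 1 / 2 * ∫ y in x..x + 1, S.dissipation y t :=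
      continuous_const.add (cD.const_mul _)
    rw [intervalIntegral.integral_add ((cG.const_mul _).intervalIntegrable _ _)
      (cR.intervalIntegrable _ _),
      intervalIntegral.integral_add (by simp) ((cD.const_mul _).intervalIntegrable _ _),
      intervalIntegral.integral_const_mul, intervalIntegral.integral_const_mul] at h1
    simp only [intervalIntegral.integral_const, sub_zero, smul_eq_mul] at h1
    have h2 : (1 / c + C) * ∫ t in (0 : ℝ)..τ, G t ≤ (1 / c + C) * M := by gcongr
    have h3 : τ * (C / c) ≤ T * (C / c) := by
      have := hτ.2
      gcongr
    have h4 := h.dissipation_unit_le hα x hτ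
    unfold rectInt at h4
    have h5 : (1 / c + C) * M = M / c + C * M := by ring
    linarith
  have h1 := h.impulse_le hα hδ x hτ
  have h2 := (viscPrim_le (α := α) (S.v_pos x 0)).trans (h.v₀_le x)
  have h3 := Real.rpow_le_rpow_of_nonpos hc (hcv x τ hτ) (neg_nonpos.2 hα)
  have h4 : S.impulse x τ
      = viscPrim α (S.v x τ) - viscPrim α (S.v x 0) - ∫ s in (0 : ℝ)..τ, S.pressure x s := rfl
  have h5 : viscPrim α (S.v x τ) = Real.log (S.v x τ) - S.v x τ ^ (-α) := rfl
  rw [← Real.log_le_iff_le_exp (S.v_pos x τ)]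
  linarith

end MHDFlow.Controlled

lemma one_fourth_le_cutPow_zero {s : ℝ} (hs : 4 ≤ s) : 1 / 4 ≤ cutPow 0 s := by
  have hs0 : 0 < s := by linarith
  rw [cutPow_of_ge (by linarith), sub_zero, Real.rpow_neg hs0.le, Real.rpow_two,
    ← div_eq_mul_inv, le_div_iff₀ (by positivity)]
  nlinarith

/-- Bound of the transverse gradients on space-time windows in terms of the data. -/
theorem exists_gradient_bound {α β T δ V₀ C : ℝ} (hα : 0 ≤ α) (hβ : 0 < β) (hT : 0 < T)
    (hδ : 0 < δ) (hC : 0 ≤ C) :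
    ∃ B : ℝ, 0 < B ∧ ∀ S : MHDFlow α β T, S.Controlled δ V₀ C → ∀ N : ℝ, 0 ≤ N →
      rectInt (-N) N T (fun x t => S.b₁x x t ^ 2 + S.b₂x x t ^ 2
        + (S.w₁x x t ^ 2 + S.w₂x x t ^ 2)) ≤ B := by
  obtain ⟨c, hc, L₀, hL₀⟩ :=
    exists_volume_lower_bound (β := β) (T := T) (V₀ := V₀) hα hδ hC
  obtain ⟨M, hM, hMG⟩ := exists_temperature_bound (δ := δ) (V₀ := V₀) hα hβ hT hC hc
  set V := Real.exp (V₀ + (4 * C + 4 - viscPrim α δ) + (M / c + C / c * T + C * M + C)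
      + c ^ (-α)) with hV
  have hV0 : 0 < V := Real.exp_pos _
  refine ⟨V * 4 * (2 * (6 * C + C / c * M)) + V * 4 * C + 1, by positivity,
    fun S hS N hN => ?_⟩
  have hcv : ∀ x, ∀ t ∈ Icc 0 T, c ≤ S.v x t := fun x t ht => (hL₀ S hS x t ht).2
  obtain ⟨G, cG, hG0, hG, hGM⟩ := hMG S hS hcv
  obtain ⟨R, hR0, hR⟩ := S.exists_θ_le_two
  have hTT : T ∈ Icc 0 T := ⟨hT.le, le_rfl⟩
  set W := max N R with hW
  have hWN : N ≤ W := le_max_left _ _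
  have hW0 : 0 ≤ W := hN.trans hWN
  have hheat := hS.heat_le hα hT.le le_rfl hc hcv hW0
    (fun x t hx => hR x t (hx ▸ le_max_right _ _)) cG hG0 fun x t ht _ => by
      simpa using hG x t ht
  rw [zero_mul, add_zero] at hheat
  have hdis := hS.dissipation_le hW0 hTT
  have cgrad : Continuous fun p : ℝ × ℝ => S.b₁x p.1 p.2 ^ 2 + S.b₂x p.1 p.2 ^ 2
      + (S.w₁x p.1 p.2 ^ 2 + S.w₂x p.1 p.2 ^ 2) :=
    ((S.cb₁x.pow 2).add (S.cb₂x.pow 2)).add ((S.cw₁x.pow 2).add (S.cw₂x.pow 2))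
  have cQ : Continuous fun p : ℝ × ℝ =>
      V * 4 * (S.heating p.1 p.2 * cutPow 0 (S.θ p.1 p.2)) :=
    (S.continuous_heating.mul (S.continuous_comp_θ (continuous_cutPow 0))).const_mul _
  have cD : Continuous fun p : ℝ × ℝ => V * 4 * S.dissipation p.1 p.2 :=
    S.continuous_dissipation.const_mul _
  have hmono := rectInt_mono (by linarith : -W ≤ W) hT.le
    (g := fun x t => V * 4 * (S.heating x t * cutPow 0 (S.θ x t)) + V * 4 * S.dissipation x t)
    cgrad (cQ.add cD) fun x _ t ht => by
      have hv := S.v_pos x t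
      have hθ := S.θ_pos x t
      have hQ := S.heating_nonneg hα x t
      have hf := cutPow_nonneg 0 (S.θ x t)
      have hD := S.conduction_nonneg x t
      have hvV := hS.v_le hα hδ hC hc hcv cG hG0 hG hGM x ht
      have h1 : S.b₁x x t ^ 2 + S.b₂x x t ^ 2 + (S.w₁x x t ^ 2 + S.w₂x x t ^ 2)
          ≤ S.v x t * S.heating x t := by
        unfold MHDFlow.heating
        rw [mul_div_cancel₀ _ hv.ne']
        have h2 : 0 ≤ visc α (S.v x t) * S.ux x t ^ 2 :=
          mul_nonneg (zero_le_one.trans (visc_ge_one hα hv)) (sq_nonneg _)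
        linarith
      have h2 : S.heating x t
          ≤ 4 * (S.heating x t * cutPow 0 (S.θ x t)) + 4 * S.dissipation x t := by
        have h3 : 0 ≤ S.conduction x t / S.θ x t / S.θ x t := by positivity
        have h4 : 0 ≤ S.heating x t / S.θ x t := by positivity
        have h5 : 0 ≤ S.heating x t * cutPow 0 (S.θ x t) := by positivity
        unfold MHDFlow.dissipation
        rcases le_total (S.θ x t) 4 with h | h
        · have h6 : S.heating x t / 4 ≤ S.heating x t / S.θ x t := by gcongr
          linarith
        · have := mul_le_mul_of_nonneg_left (one_fourth_le_cutPow_zero h) hQ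
          linarith
      calc _ ≤ S.v x t * S.heating x t := h1
        _ ≤ V * S.heating x t := by gcongr
        _ ≤ V * (4 * (S.heating x t * cutPow 0 (S.θ x t)) + 4 * S.dissipation x t) := by
            gcongr
        _ = _ := by ring
  rw [rectInt_add (f := fun x t => V * 4 * (S.heating x t * cutPow 0 (S.θ x t))) cQ cD,
    rectInt_const_mul, rectInt_const_mul] at hmono
  have hsub := rectInt_le_of_subinterval hT.le (f := fun x t => S.b₁x x t ^ 2
    + S.b₂x x t ^ 2 + (S.w₁x x t ^ 2 + S.w₂x x t ^ 2)) cgrad (fun x t => by positivity)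
    (by linarith : -W ≤ -N) (by linarith : -N ≤ N) hWN
  refine (hsub.trans hmono).trans ?_
  have h1 : C / c * ∫ t in (0 : ℝ)..T, G t ≤ C / c * M := by gcongr
  have h2 : rectInt (-W) W T (fun x t => S.heating x t * cutPow 0 (S.θ x t))
      ≤ 2 * (6 * C + C / c * M) := by linarith
  have h3 := mul_le_mul_of_nonneg_left h2 (by positivity : 0 ≤ V * 4)
  have h4 := mul_le_mul_of_nonneg_left hdis (by positivity : 0 ≤ V * 4)
  linarith

/-! ### From classical solutions to the componentwise form -/

lemma HasDerivAt.fst_comp {f : ℝ → ℝ × ℝ} {f' : ℝ × ℝ} {x : ℝ} (h : HasDerivAt f f' x) :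
    HasDerivAt (fun y => (f y).1) f'.1 x := h.fst

lemma HasDerivAt.snd_comp {f : ℝ → ℝ × ℝ} {f' : ℝ × ℝ} {x : ℝ} (h : HasDerivAt f f' x) :
    HasDerivAt (fun y => (f y).2) f'.2 x := h.snd

namespace IsClassicalSolution

variable {α β T : ℝ} {v u θ : ℝ → ℝ → ℝ} {w b : ℝ → ℝ → ℝ × ℝ}

lemma differentiableAt_sq2_b (H : IsClassicalSolution α β T v u θ w b) {x t : ℝ}
    (ht : t ∈ Icc 0 T) :
    DifferentiableAt ℝ (fun y => sq2 (b y t)) x := by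
  have h := (H.diff_x x t ht).2.2.2.2
  exact (h.fst.pow 2).add (h.snd.pow 2)

lemma hasDerivAt_stress (H : IsClassicalSolution α β T v u θ w b) {x t : ℝ}
    (ht : t ∈ Icc 0 T) :
    HasDerivAt (fun y => visc α (v y t) * pdx u y t / v y t
      - (θ y t / v y t + sq2 (b y t) / 2)) (pdt T u x t) x := by
  obtain ⟨dv, -, dθ, -, -⟩ := H.diff_x x t ht
  have hv := (H.v_pos x t ht).ne'
  have dvisc : DifferentiableAt ℝ (fun y => visc α (v y t)) x :=
    ((dv.rpow_const (Or.inl hv)).const_mul α).const_add 1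
  have h1 := ((dvisc.mul (H.diff_xx x t ht).1).div dv hv).hasDerivAt
  have h2 := ((dθ.div dv hv).add ((H.differentiableAt_sq2_b ht).div_const 2)).hasDerivAt
  exact (h1.sub h2).congr_deriv (sub_eq_iff_eq_add.2 (H.eq_mom x t ht).symm)

lemma hasDerivAt_heat (H : IsClassicalSolution α β T v u θ w b) {x t : ℝ}
    (ht : t ∈ Icc 0 T) :
    HasDerivAt (fun y => θ y t ^ β * pdx θ y t / v y t)
      (pdt T θ x t + θ x t / v x t * pdx u x t
        - (visc α (v x t) * pdx u x t ^ 2 + sq2 (pdx w x t) + sq2 (pdx b x t)) / v x t) x := by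
  obtain ⟨dv, -, dθ, -, -⟩ := H.diff_x x t ht
  have h1 := (((dθ.rpow_const (p := β) (Or.inl (H.θ_pos x t ht).ne')).mul
    (H.diff_xx x t ht).2.1).div dv (H.v_pos x t ht).ne').hasDerivAt
  exact h1.congr_deriv (eq_sub_of_add_eq (H.eq_temp x t ht).symm)

lemma hasDerivAt_w_flux (H : IsClassicalSolution α β T v u θ w b) {x t : ℝ}
    (ht : t ∈ Icc 0 T) :
    HasDerivAt (fun y => (v y t)⁻¹ • pdx w y t) (pdt T w x t - pdx b x t) x := by
  have h1 := (((H.diff_x x t ht).1.inv (H.v_pos x t ht).ne').smul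
    (H.diff_xx x t ht).2.2.1).hasDerivAt
  exact h1.congr_deriv (H.eq_w x t ht).symm

lemma hasDerivAt_b_flux (H : IsClassicalSolution α β T v u θ w b) (hT : 0 < T)
    {x t : ℝ} (ht : t ∈ Icc 0 T) :
    HasDerivAt (fun y => (v y t)⁻¹ • pdx b y t)
      (pdx u x t • b x t + v x t • pdt T b x t - pdx w x t) x := by
  have h1 := (((H.diff_x x t ht).1.inv (H.v_pos x t ht).ne').smul
    (H.diff_xx x t ht).2.2.2).hasDerivAt
  refine h1.congr_deriv ((H.eq_b x t ht).symm.trans ?_)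
  obtain ⟨dv, -, -, -, db⟩ := H.diff_t x t ht
  have h2 : pdt T (fun y s => v y s • b y s) x t = v x t • pdt T b x t + pdt T v x t • b x t :=
    (dv.hasDerivWithinAt.smul db.hasDerivWithinAt).derivWithin (uniqueDiffOn_Icc hT t ht)
  rw [h2, H.eq_mass x t ht, add_comm]

lemma tendsto_far (H : IsClassicalSolution α β T v u θ w b) (hT : 0 ≤ T)
    {f : ℝ → ℝ → ℝ} {l : ℝ}
    (h : ∀ ε > 0, ∀ x, ∀ t ∈ Icc 0 T, (|v x t - 1| < ε ∧ |u x t| < ε ∧ |θ x t - 1| < ε ∧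
      Real.sqrt (sq2 (b x t)) < ε ∧ Real.sqrt (sq2 (w x t)) < ε) → |f x t - l| < ε) :
    Tendsto (fun p : ℝ × ℝ => f p.1 (projIcc 0 T hT p.2)) (comap (fun p => |p.1|) atTop)
      (nhds l) := by
  rw [Metric.tendsto_nhds]
  intro ε hε
  obtain ⟨M, hM⟩ := H.farfield ε hε
  filter_upwards [preimage_mem_comap (Ici_mem_atTop M)] with p hp
  have ht := (projIcc 0 T hT p.2).2
  exact h ε hε _ _ ht (hM _ _ ht hp)

end IsClassicalSolution

lemma continuous_clamp {E : Type*} [TopologicalSpace E] {T : ℝ} (hT : 0 ≤ T) {f : ℝ → ℝ → E}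
    (hf : ContinuousOn (fun p : ℝ × ℝ => f p.1 p.2) (univ ×ˢ Icc 0 T)) :
    Continuous fun p : ℝ × ℝ => f p.1 (projIcc 0 T hT p.2) :=
  hf.comp_continuous (f := fun p : ℝ × ℝ => (p.1, (projIcc 0 T hT p.2 : ℝ)))
    (by fun_prop) fun p => ⟨trivial, (projIcc 0 T hT p.2).2⟩

lemma hasDerivWithinAt_clamp {E : Type*} [NormedAddCommGroup E] [NormedSpace ℝ E] {T : ℝ}
    (hT : 0 ≤ T) {f : ℝ → ℝ → E} {x t : ℝ} (ht : t ∈ Icc 0 T)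
    (hf : ∀ t ∈ Icc 0 T, DifferentiableWithinAt ℝ (fun s => f x s) (Icc 0 T) t) :
    HasDerivWithinAt (fun s => f x (projIcc 0 T hT s)) (pdt T f x (projIcc 0 T hT t))
      (Icc 0 T) t := by
  rw [projIcc_of_mem hT ht]
  refine (hf t ht).hasDerivWithinAt.congr (fun s hs => ?_) ?_
  · rw [projIcc_of_mem hT hs]
  · rw [projIcc_of_mem hT ht]

lemma abs_fst_le_sqrt_sq2 (p : ℝ × ℝ) : |p.1| ≤ Real.sqrt (sq2 p) :=
  Real.abs_le_sqrt (le_add_of_nonneg_right (sq_nonneg _))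

lemma abs_snd_le_sqrt_sq2 (p : ℝ × ℝ) : |p.2| ≤ Real.sqrt (sq2 p) :=
  Real.abs_le_sqrt (le_add_of_nonneg_left (sq_nonneg _))

/-- The componentwise form of a classical solution, with the time variable clamped to `[0, T]`. -/
def IsClassicalSolution.toFlow {α β T : ℝ} {v u θ : ℝ → ℝ → ℝ} {w b : ℝ → ℝ → ℝ × ℝ}
    (H : IsClassicalSolution α β T v u θ w b) (hT : 0 < T) : MHDFlow α β T where
  v x t := v x (projIcc 0 T hT.le t)
  u x t := u x (projIcc 0 T hT.le t)
  θ x t := θ x (projIcc 0 T hT.le t)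
  w₁ x t := (w x (projIcc 0 T hT.le t)).1
  w₂ x t := (w x (projIcc 0 T hT.le t)).2
  b₁ x t := (b x (projIcc 0 T hT.le t)).1
  b₂ x t := (b x (projIcc 0 T hT.le t)).2
  ux x t := pdx u x (projIcc 0 T hT.le t)
  θx x t := pdx θ x (projIcc 0 T hT.le t)
  w₁x x t := (pdx w x (projIcc 0 T hT.le t)).1
  w₂x x t := (pdx w x (projIcc 0 T hT.le t)).2
  b₁x x t := (pdx b x (projIcc 0 T hT.le t)).1
  b₂x x t := (pdx b x (projIcc 0 T hT.le t)).2
  ut x t := pdt T u x (projIcc 0 T hT.le t)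
  θt x t := pdt T θ x (projIcc 0 T hT.le t)
  w₁t x t := (pdt T w x (projIcc 0 T hT.le t)).1
  w₂t x t := (pdt T w x (projIcc 0 T hT.le t)).2
  b₁t x t := (pdt T b x (projIcc 0 T hT.le t)).1
  b₂t x t := (pdt T b x (projIcc 0 T hT.le t)).2
  v_pos x t := H.v_pos x _ (projIcc 0 T hT.le t).2
  θ_pos x t := H.θ_pos x _ (projIcc 0 T hT.le t).2
  cv := continuous_clamp hT.le H.cont.fst
  cu := continuous_clamp hT.le H.cont.snd.fst
  cθ := continuous_clamp hT.le H.cont.snd.snd.fst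
  cw₁ := (continuous_clamp hT.le H.cont.snd.snd.snd.fst).fst
  cw₂ := (continuous_clamp hT.le H.cont.snd.snd.snd.fst).snd
  cb₁ := (continuous_clamp hT.le H.cont.snd.snd.snd.snd).fst
  cb₂ := (continuous_clamp hT.le H.cont.snd.snd.snd.snd).snd
  cux := continuous_clamp hT.le H.cont_dx.snd.fst
  cθx := continuous_clamp hT.le H.cont_dx.snd.snd.fst
  cw₁x := (continuous_clamp hT.le H.cont_dx.snd.snd.snd.fst).fst
  cw₂x := (continuous_clamp hT.le H.cont_dx.snd.snd.snd.fst).snd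
  cb₁x := (continuous_clamp hT.le H.cont_dx.snd.snd.snd.snd).fst
  cb₂x := (continuous_clamp hT.le H.cont_dx.snd.snd.snd.snd).snd
  cut := continuous_clamp hT.le H.cont_dt.snd.fst
  cθt := continuous_clamp hT.le H.cont_dt.snd.snd.fst
  cw₁t := (continuous_clamp hT.le H.cont_dt.snd.snd.snd.fst).fst
  cw₂t := (continuous_clamp hT.le H.cont_dt.snd.snd.snd.fst).snd
  cb₁t := (continuous_clamp hT.le H.cont_dt.snd.snd.snd.snd).fst
  cb₂t := (continuous_clamp hT.le H.cont_dt.snd.snd.snd.snd).snd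
  u_dx x t := (H.diff_x x _ (projIcc 0 T hT.le t).2).2.1.hasDerivAt
  θ_dx x t := (H.diff_x x _ (projIcc 0 T hT.le t).2).2.2.1.hasDerivAt
  w₁_dx x t := (H.diff_x x _ (projIcc 0 T hT.le t).2).2.2.2.1.hasDerivAt.fst
  w₂_dx x t := (H.diff_x x _ (projIcc 0 T hT.le t).2).2.2.2.1.hasDerivAt.snd
  b₁_dx x t := (H.diff_x x _ (projIcc 0 T hT.le t).2).2.2.2.2.hasDerivAt.fst
  b₂_dx x t := (H.diff_x x _ (projIcc 0 T hT.le t).2).2.2.2.2.hasDerivAt.snd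
  v_dt x t ht := (hasDerivWithinAt_clamp hT.le ht fun t ht => (H.diff_t x t ht).1).congr_deriv
    (H.eq_mass x _ (projIcc 0 T hT.le t).2)
  u_dt x t ht := hasDerivWithinAt_clamp hT.le ht fun t ht => (H.diff_t x t ht).2.1
  θ_dt x t ht := hasDerivWithinAt_clamp hT.le ht fun t ht => (H.diff_t x t ht).2.2.1
  w₁_dt x t ht := (hasDerivWithinAt_clamp hT.le ht fun t ht => (H.diff_t x t ht).2.2.2.1).fst
  w₂_dt x t ht := (hasDerivWithinAt_clamp hT.le ht fun t ht => (H.diff_t x t ht).2.2.2.1).snd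
  b₁_dt x t ht := (hasDerivWithinAt_clamp hT.le ht fun t ht => (H.diff_t x t ht).2.2.2.2).fst
  b₂_dt x t ht := (hasDerivWithinAt_clamp hT.le ht fun t ht => (H.diff_t x t ht).2.2.2.2).snd
  stress_dx x t _ := H.hasDerivAt_stress (projIcc 0 T hT.le t).2
  heat_dx x t _ := H.hasDerivAt_heat (projIcc 0 T hT.le t).2
  w₁_flux x t _ := by
    simpa [inv_mul_eq_div] using (H.hasDerivAt_w_flux (x := x) (projIcc 0 T hT.le t).2).fst_comp
  w₂_flux x t _ := by
    simpa [inv_mul_eq_div] using (H.hasDerivAt_w_flux (x := x) (projIcc 0 T hT.le t).2).snd_comp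
  b₁_flux x t _ := by
    simpa [inv_mul_eq_div] using (H.hasDerivAt_b_flux hT (x := x) (projIcc 0 T hT.le t).2).fst_comp
  b₂_flux x t _ := by
    simpa [inv_mul_eq_div] using (H.hasDerivAt_b_flux hT (x := x) (projIcc 0 T hT.le t).2).snd_comp
  v_far := H.tendsto_far hT.le fun _ _ _ _ _ h => h.1
  u_far := H.tendsto_far hT.le fun _ _ _ _ _ h => by simpa using h.2.1
  θ_far := H.tendsto_far hT.le fun _ _ _ _ _ h => h.2.2.1
  w₁_far := H.tendsto_far hT.le (f := fun x t => (w x t).1) fun _ _ _ _ _ h => by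
    simpa using (abs_fst_le_sqrt_sq2 _).trans_lt h.2.2.2.2
  w₂_far := H.tendsto_far hT.le (f := fun x t => (w x t).2) fun _ _ _ _ _ h => by
    simpa using (abs_snd_le_sqrt_sq2 _).trans_lt h.2.2.2.2
  b₁_far := H.tendsto_far hT.le (f := fun x t => (b x t).1) fun _ _ _ _ _ h => by
    simpa using (abs_fst_le_sqrt_sq2 _).trans_lt h.2.2.2.1
  b₂_far := H.tendsto_far hT.le (f := fun x t => (b x t).2) fun _ _ _ _ _ h => by
    simpa using (abs_snd_le_sqrt_sq2 _).trans_lt h.2.2.2.1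

/-! ### Initial data and passage to the whole line -/

lemma intervalIntegral_le_integral {f : ℝ → ℝ} {a b : ℝ} (hf : Integrable f) (h0 : ∀ x, 0 ≤ f x)
    (hab : a ≤ b) : ∫ x in a..b, f x ≤ ∫ x, f x := by
  rw [intervalIntegral.integral_of_le hab]
  exact setIntegral_le_integral hf (ae_of_all _ h0)

lemma integral_integral_le_of_rectInt_le {f : ℝ → ℝ → ℝ} {T B : ℝ}
    (hf : Continuous fun p : ℝ × ℝ => f p.1 p.2) (h0 : ∀ x t, 0 ≤ f x t)
    (hint : ∀ t, Integrable fun x => f x t) (hB0 : 0 ≤ B)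
    (hB : ∀ N : ℝ, 0 ≤ N → rectInt (-N) N T f ≤ B) :
    ∫ t in (0 : ℝ)..T, ∫ x, f x t ≤ B := by
  by_cases hF : IntervalIntegrable (fun t => ∫ x, f x t) volume 0 T
  · refine le_of_tendsto (f := fun n : ℕ => rectInt (-n) n T f) (x := atTop) ?_
      (Eventually.of_forall fun n => hB n n.cast_nonneg)
    refine intervalIntegral.tendsto_integral_filter_of_dominated_convergence
      (fun t => ∫ x, f x t) (Eventually.of_forall fun n =>
        (continuous_integral_strip hf _ _).aestronglyMeasurable)
      (Eventually.of_forall fun n => ae_of_all _ fun t _ => ?_) hF (ae_of_all _ fun t _ => ?_)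
    · have hn : -(n : ℝ) ≤ n := by
        have := n.cast_nonneg (α := ℝ)
        linarith
      rw [Real.norm_of_nonneg (intervalIntegral.integral_nonneg hn fun x _ => h0 x t)]
      exact intervalIntegral_le_integral (hint t) (fun x => h0 x t) hn
    · exact intervalIntegral_tendsto_integral (hint t)
        (tendsto_neg_atTop_atBot.comp tendsto_natCast_atTop_atTop) tendsto_natCast_atTop_atTop
  · rwa [intervalIntegral.integral_undef hF]

lemma sub_one_sub_log_le {δ z : ℝ} (hδ : 0 < δ) (hz : δ ≤ z) :
    z - 1 - Real.log z ≤ 1 / δ * (z - 1) ^ 2 := by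
  have hz0 := hδ.trans_le hz
  have h1 := Real.one_sub_inv_le_log_of_pos hz0
  have h2 : z - 1 - (1 - z⁻¹) = 1 / z * (z - 1) ^ 2 := by
    field_simp
  have h3 : 1 / z * (z - 1) ^ 2 ≤ 1 / δ * (z - 1) ^ 2 := by gcongr
  linarith

/-- The density whose integral at time `0` is controlled by admissibility. -/
def dataDensity (v u θ : ℝ → ℝ → ℝ) (w b : ℝ → ℝ → ℝ × ℝ) (x : ℝ) : ℝ :=
  (v x 0 - 1) ^ 2 + (u x 0) ^ 2 + (θ x 0 - 1) ^ 2 + sq2 (b x 0) + sq2 (w x 0)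
    + (pdx v x 0) ^ 2 + (pdx u x 0) ^ 2 + (pdx θ x 0) ^ 2
    + sq2 (pdx b x 0) + sq2 (pdx w x 0)

lemma sq2_nonneg (p : ℝ × ℝ) : 0 ≤ sq2 p := add_nonneg (sq_nonneg _) (sq_nonneg _)

section Data

variable {α β T K δ : ℝ} {v u θ : ℝ → ℝ → ℝ} {w b : ℝ → ℝ → ℝ × ℝ}

lemma le_dataDensity (x : ℝ) :
    (v x 0 - 1) ^ 2 + (u x 0) ^ 2 + (θ x 0 - 1) ^ 2 + sq2 (b x 0) + sq2 (w x 0)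
      + (pdx v x 0) ^ 2 ≤ dataDensity v u θ w b x := by
  have := sq_nonneg (pdx u x 0)
  have := sq_nonneg (pdx θ x 0)
  have := sq2_nonneg (pdx b x 0)
  have := sq2_nonneg (pdx w x 0)
  unfold dataDensity
  linarith

lemma dataDensity_nonneg (x : ℝ) : 0 ≤ dataDensity v u θ w b x := by
  have := sq2_nonneg (b x 0)
  have := sq2_nonneg (w x 0)
  exact le_trans (by positivity) (le_dataDensity x)

lemma IsClassicalSolution.integrable_dataDensity (H : IsClassicalSolution α β T v u θ w b)
    (hT : 0 ≤ T) : Integrable (dataDensity v u θ w b) := by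
  obtain ⟨h1, h2, h3, h4, h5, h6, h7, h8, h9, h10⟩ := H.sq_int 0 ⟨le_rfl, hT⟩
  exact ((((((((h1.add h2).add h3).add h4).add h5).add h6).add h7).add h8).add h9).add h10

lemma IsClassicalSolution.integral_dataDensity_le (H : IsClassicalSolution α β T v u θ w b)
    (hT : 0 ≤ T) (hA : Admissible K δ v u θ w b) {a b' : ℝ} (hab : a ≤ b') :
    ∫ x in a..b', dataDensity v u θ w b x ≤ K ^ 2 :=
  (intervalIntegral_le_integral (H.integrable_dataDensity hT) dataDensity_nonneg hab).trans hA.1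

lemma IsClassicalSolution.initial_v_le (H : IsClassicalSolution α β T v u θ w b)
    (hT : 0 ≤ T) (hA : Admissible K δ v u θ w b) (x : ℝ) : v x 0 ≤ 2 + 2 * K ^ 2 := by
  have h0 : (0 : ℝ) ∈ Icc 0 T := ⟨le_rfl, hT⟩
  have hd : ∀ y, HasDerivAt (fun y => v y 0) (pdx v y 0) y :=
    fun y => (H.diff_x y 0 h0).1.hasDerivAt
  have cv : Continuous fun y => v y 0 := continuous_iff_continuousAt.2 fun y => (hd y).continuousAt
  have cvx : Continuous fun y => pdx v y 0 :=
    H.cont_dx.fst.comp_continuous (f := fun y : ℝ => (y, (0 : ℝ))) (by fun_prop)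
      fun y => ⟨trivial, h0⟩
  have key := le_integral_add_integral_of_abs_deriv_le
    (f := fun y => (v y 0 - 1) ^ 2) (f' := fun y => 2 * (v y 0 - 1) * pdx v y 0)
    (g := fun y => (v y 0 - 1) ^ 2 + pdx v y 0 ^ 2)
    (fun y => (((hd y).sub_const 1).pow 2).congr_deriv (by simp)) (by fun_prop) (by fun_prop)
    (fun y => abs_le.2 ⟨by nlinarith [sq_nonneg (v y 0 - 1 + pdx v y 0)],
      by nlinarith [sq_nonneg (v y 0 - 1 - pdx v y 0)]⟩)
    (⟨le_rfl, by linarith⟩ : x ∈ Icc x (x + 1))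
  have hle : ∀ y, (v y 0 - 1) ^ 2 + pdx v y 0 ^ 2 ≤ dataDensity v u θ w b y := fun y => by
    have := sq2_nonneg (b y 0)
    have := sq2_nonneg (w y 0)
    have := le_dataDensity (v := v) (u := u) (θ := θ) (w := w) (b := b) y
    have := sq_nonneg (u y 0)
    have := sq_nonneg (θ y 0 - 1)
    linarith
  have hx : x ≤ x + 1 := by linarith
  have hI := (H.integrable_dataDensity hT).intervalIntegrable (a := x) (b := x + 1)
  have h1 := intervalIntegral.integral_mono_on hx (g := dataDensity v u θ w b)
    (by apply Continuous.intervalIntegrable; fun_prop) hI fun y _ => hle y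
  have h2 := intervalIntegral.integral_mono_on hx (f := fun y => (v y 0 - 1) ^ 2)
    (g := dataDensity v u θ w b) (by apply Continuous.intervalIntegrable; fun_prop) hI
    fun y _ => (le_add_of_nonneg_right (sq_nonneg _)).trans (hle y)
  have h3 := H.integral_dataDensity_le hT hA hx
  nlinarith [sq_nonneg (v x 0 - 1 - 1 / 2)]

lemma IsClassicalSolution.controlled (H : IsClassicalSolution α β T v u θ w b) (hα : 0 ≤ α)
    (hT : 0 < T) (hδ : 0 < δ) (hA : Admissible K δ v u θ w b) :
    (H.toFlow hT).Controlled δ (2 + 2 * K ^ 2)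
      (4 * ((1 / δ + (2 + 2 * K ^ 2)) * K ^ 2 + 1)) := by
  have hp : (projIcc 0 T hT.le 0 : ℝ) = 0 := by simp
  have hV : ∀ x, (H.toFlow hT).v x 0 = v x 0 := fun x => congrArg (v x) hp
  refine ⟨fun x => (hA.2.1 x).trans (hV x).ge, fun x => (hV x).le.trans
    (H.initial_v_le hT.le hA x), fun N τ hN hτ =>
      (H.toFlow hT).entropy_window_le hα hT (fun N hN => ?_) hN hτ⟩
  have hNN : -N ≤ N := by linarith
  have key : ∀ x, (H.toFlow hT).entropy x 0
      ≤ (1 / δ + (2 + 2 * K ^ 2)) * dataDensity v u θ w b x := by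
    intro x
    have he : (H.toFlow hT).entropy x 0 = u x 0 ^ 2 / 2 + (v x 0 - 1 - Real.log (v x 0))
        + (θ x 0 - 1 - Real.log (θ x 0)) + sq2 (w x 0) / 2 + v x 0 * sq2 (b x 0) / 2 := by
      simp only [MHDFlow.entropy, IsClassicalSolution.toFlow, hp, sq2]
    have h1 := sub_one_sub_log_le hδ (hA.2.1 x)
    have h2 := sub_one_sub_log_le hδ (hA.2.2 x)
    have h3 := mul_le_mul_of_nonneg_right (H.initial_v_le hT.le hA x) (sq2_nonneg (b x 0))
    have h4 := le_dataDensity (v := v) (u := u) (θ := θ) (w := w) (b := b) x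
    have h5 := sq2_nonneg (b x 0)
    have h6 := sq2_nonneg (w x 0)
    have hδ' : 0 < 1 / δ := by positivity
    refine le_trans ?_ (mul_le_mul_of_nonneg_left h4 (by positivity))
    rw [he]
    have h7 : 0 ≤ 1 / δ * (u x 0 ^ 2 + sq2 (b x 0) + sq2 (w x 0) + pdx v x 0 ^ 2) := by positivity
    have h8 : 0 ≤ 2 * K ^ 2 * (u x 0 ^ 2 + sq2 (w x 0) + sq2 (b x 0) + pdx v x 0 ^ 2
      + (v x 0 - 1) ^ 2 + (θ x 0 - 1) ^ 2) := by positivity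
    have h9 := sq_nonneg (u x 0)
    have h10 := sq_nonneg (v x 0 - 1)
    have h11 := sq_nonneg (θ x 0 - 1)
    have h12 := sq_nonneg (pdx v x 0)
    have h13 : 0 ≤ K ^ 2 * sq2 (b x 0) := by positivity
    nlinarith
  have hI := ((H.integrable_dataDensity hT.le).const_mul
    (1 / δ + (2 + 2 * K ^ 2))).intervalIntegrable (a := -N) (b := N)
  have h1 := intervalIntegral.integral_mono_on hNN
    ((continuous_slice_left (H.toFlow hT).continuous_entropy 0).intervalIntegrable _ _) hI
    fun x _ => key x
  rw [intervalIntegral.integral_const_mul] at h1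
  exact h1.trans (mul_le_mul_of_nonneg_left (H.integral_dataDensity_le hT.le hA hNN)
    (by positivity))

end Data

/-- (2.28) of the paper: space-time bound for `|b_x|² + |w_x|²`. -/
theorem bx_wx_space_time_bound (α β T K δ : ℝ) (hα : 0 ≤ α) (hβ : 0 < β) (hT : 0 < T)
    (hK : 0 < K) (hδ₀ : 0 < δ) (hδ₁ : δ ≤ 1) :
    ∃ C : ℝ, 0 < C ∧
      ∀ (v u θ : ℝ → ℝ → ℝ) (w b : ℝ → ℝ → ℝ × ℝ),
        IsClassicalSolution α β T v u θ w b → Admissible K δ v u θ w b →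
        (∫ t in (0:ℝ)..T, ∫ x : ℝ, (sq2 (pdx b x t) + sq2 (pdx w x t))) ≤ C := by
  obtain ⟨B, hB, hS⟩ := exists_gradient_bound (V₀ := 2 + 2 * K ^ 2)
    (C := 4 * ((1 / δ + (2 + 2 * K ^ 2)) * K ^ 2 + 1)) hα hβ hT hδ₀ (by positivity)
  refine ⟨B, hB, fun v u θ w b H hA => ?_⟩
  set S := H.toFlow hT with hSdef
  have hc := hS S (H.controlled hα hT hδ₀ hA)
  have hcont : Continuous fun p : ℝ × ℝ => S.b₁x p.1 p.2 ^ 2 + S.b₂x p.1 p.2 ^ 2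
      + (S.w₁x p.1 p.2 ^ 2 + S.w₂x p.1 p.2 ^ 2) :=
    ((S.cb₁x.pow 2).add (S.cb₂x.pow 2)).add ((S.cw₁x.pow 2).add (S.cw₂x.pow 2))
  refine le_of_eq_of_le (intervalIntegral.integral_congr fun t ht => ?_)
    (integral_integral_le_of_rectInt_le (f := fun x t => S.b₁x x t ^ 2 + S.b₂x x t ^ 2
      + (S.w₁x x t ^ 2 + S.w₂x x t ^ 2)) hcont (fun x t => by positivity) (fun t => ?_) hB.le hc)
  · rw [uIcc_of_le hT.le] at ht
    simp only [hSdef, IsClassicalSolution.toFlow, projIcc_of_mem hT.le ht, sq2]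
  · have h := H.sq_int _ (projIcc 0 T hT.le t).2
    exact h.2.2.2.2.2.2.2.2.1.add h.2.2.2.2.2.2.2.2.2
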